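/- arXiv:1405.0040 — 5 statements merged into one kernel-verified Lean document; each statement's English description precedes it below -/
import Mathlib

section
/- Every weakly almost periodic function on ℝ^d is uniformly continuous. Precisely: let f : ℝ^d → ℝ be bounded and continuous, and suppose that for every sequence (λ_k) in ℝ^d there exist a subsequence (λ_{k_j}) and a bounded continuous function g : ℝ^d → ℝ such that the translates x ↦ f(x + λ_{k_j}) converge to g in the weak topology of the Banach space C_b(ℝ^d; ℝ) of bounded continuous real-valued functions with the sup norm. Then f is uniformly continuous on ℝ^d. -/
open MeasureTheory Filter Topology

/-- The translate of a bounded continuous function `f` by `l`: the function `x ↦ f (x + l)`. -/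
noncomputable def translateBCF {d : ℕ}
    (f : BoundedContinuousFunction (EuclideanSpace ℝ (Fin d)) ℝ)
    (l : EuclideanSpace ℝ (Fin d)) :
    BoundedContinuousFunction (EuclideanSpace ℝ (Fin d)) ℝ :=
  f.compContinuous ⟨fun x => x + l, by continuity⟩

/-- `f` is weakly almost periodic: every sequence of translates has a subsequence converging
in the weak topology of the Banach space of bounded continuous functions. -/
def IsWAP {d : ℕ} (f : BoundedContinuousFunction (EuclideanSpace ℝ (Fin d)) ℝ) : Prop :=
  ∀ lam : ℕ → EuclideanSpace ℝ (Fin d),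
    ∃ (φ : ℕ → ℕ) (g : BoundedContinuousFunction (EuclideanSpace ℝ (Fin d)) ℝ),
      StrictMono φ ∧
      ∀ Φ : BoundedContinuousFunction (EuclideanSpace ℝ (Fin d)) ℝ →L[ℝ] ℝ,
        Tendsto (fun j => Φ (translateBCF f (lam (φ j)))) atTop (𝓝 (Φ g))

lemma translateBCF_apply {d : ℕ}
    (f : BoundedContinuousFunction (EuclideanSpace ℝ (Fin d)) ℝ)
    (l x : EuclideanSpace ℝ (Fin d)) : translateBCF f l x = f (x + l) := rfl

/-- The set of `t` whose translate of `f` is within a fixed distance of a given function is closed. -/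
lemma isClosed_setOf_dist_translateBCF_le {d : ℕ}
    (f c : BoundedContinuousFunction (EuclideanSpace ℝ (Fin d)) ℝ) {r : ℝ} (hr : 0 ≤ r) :
    IsClosed {t | dist (translateBCF f t) c ≤ r} := by
  simp only [BoundedContinuousFunction.dist_le hr, translateBCF_apply, Set.ofPred_forall]
  exact isClosed_iInter fun x => isClosed_le (by fun_prop) continuous_const

/-- Along a subsequence of any convergent sequence `u n → t`, the translates of a weakly almost
periodic function by `u n` converge weakly to its translate by `t`. -/
lemma IsWAP.exists_subseq_tendsto {d : ℕ}
    {f : BoundedContinuousFunction (EuclideanSpace ℝ (Fin d)) ℝ} (hf : IsWAP f)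
    {u : ℕ → EuclideanSpace ℝ (Fin d)} {t : EuclideanSpace ℝ (Fin d)}
    (hu : Tendsto u atTop (𝓝 t)) :
    ∃ φ : ℕ → ℕ, StrictMono φ ∧
      ∀ Φ : BoundedContinuousFunction (EuclideanSpace ℝ (Fin d)) ℝ →L[ℝ] ℝ,
        Tendsto (fun j => Φ (translateBCF f (u (φ j)))) atTop (𝓝 (Φ (translateBCF f t))) := by
  obtain ⟨φ, g, hφ, hg⟩ := hf u
  have hgt : g = translateBCF f t := by
    ext x
    refine tendsto_nhds_unique (hg (BoundedContinuousFunction.evalCLM ℝ x)) ?_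
    exact (f.continuous.tendsto (x + t)).comp
      (tendsto_const_nhds.add (hu.comp hφ.tendsto_atTop))
  exact ⟨φ, hφ, hgt ▸ hg⟩

/-- The orbit of a weakly almost periodic function is norm separable: by Hahn–Banach it lies in the
closed span of the translates by a countable dense set. -/
lemma IsWAP.isSeparable_range {d : ℕ}
    {f : BoundedContinuousFunction (EuclideanSpace ℝ (Fin d)) ℝ} (hf : IsWAP f) :
    TopologicalSpace.IsSeparable (Set.range (translateBCF f)) := by
  obtain ⟨D, hDc, hD⟩ := TopologicalSpace.exists_countable_dense (EuclideanSpace ℝ (Fin d))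
  refine ((hDc.image (translateBCF f)).isSeparable.span (R := ℝ)).closure.mono ?_
  rintro _ ⟨t, rfl⟩
  by_contra ht
  obtain ⟨Φ, a, hΦ, ha⟩ := geometric_hahn_banach_closed_point
    (Submodule.convex _).closure isClosed_closure ht
  obtain ⟨u, huD, hu⟩ := mem_closure_iff_seq_limit.1 (hD t)
  obtain ⟨φ, -, hφ⟩ := hf.exists_subseq_tendsto hu
  exact ha.not_ge <| le_of_tendsto' (hφ Φ) fun j =>
    (hΦ _ (subset_closure (Submodule.subset_span (Set.mem_image_of_mem _ (huD (φ j)))))).le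

/-- Every weakly almost periodic function on `ℝ^d` is uniformly continuous. -/
theorem wap_uniformContinuous {d : ℕ}
    (f : BoundedContinuousFunction (EuclideanSpace ℝ (Fin d)) ℝ)
    (hf : IsWAP f) : UniformContinuous ⇑f := by
  rw [Metric.uniformContinuous_iff]
  intro ε hε
  obtain ⟨C, hCc, hC⟩ := hf.isSeparable_range
  have : Countable C := hCc.to_subtype
  obtain ⟨c, t₀, ht₀⟩ := nonempty_interior_of_iUnion_of_closed
    (f := fun c : C => {t | dist (translateBCF f t) c ≤ ε / 3})
    (fun c => isClosed_setOf_dist_translateBCF_le f c (by positivity)) <| by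
      refine Set.eq_univ_of_forall fun t => Set.mem_iUnion.2 ?_
      obtain ⟨c, hc, htc⟩ := Metric.mem_closure_iff.1 (hC ⟨t, rfl⟩) (ε / 3) (by positivity)
      exact ⟨⟨c, hc⟩, htc.le⟩
  obtain ⟨δ, hδ, hball⟩ := Metric.mem_nhds_iff.1 (mem_interior_iff_mem_nhds.1 ht₀)
  refine ⟨δ, hδ, fun {x y} hxy => ?_⟩
  have h₀ : dist (translateBCF f t₀) c ≤ ε / 3 := hball (Metric.mem_ball_self hδ)
  have h₁ : dist (translateBCF f (t₀ + (y - x))) c ≤ ε / 3 := hball <| by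
    rwa [Metric.mem_ball, dist_self_add_left, ← dist_eq_norm, dist_comm]
  have hx : f x = translateBCF f t₀ (x - t₀) := by simp [translateBCF_apply]
  have hy : f y = translateBCF f (t₀ + (y - x)) (x - t₀) := by
    rw [translateBCF_apply]; congr 1; abel
  rw [hx, hy]
  calc _ ≤ dist (translateBCF f t₀) (translateBCF f (t₀ + (y - x))) :=
        BoundedContinuousFunction.dist_coe_le_dist _
    _ ≤ _ := dist_triangle_right _ _ (c : BoundedContinuousFunction _ ℝ)
    _ < ε := by linarith
end

section
/- The product of two weakly almost periodic functions is weakly almost periodic: if f, g : ℝ^d → ℝ are bounded continuous functions belonging to WAP(ℝ^d), then the pointwise product f·g also belongs to WAP(ℝ^d). -/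
open MeasureTheory Filter Topology

namespace ContinuousMap

variable {K : Type*} [TopologicalSpace K]

/-- The values of the functional `Ψ` on the order interval `[-u, u]`. -/
def orderIntervalValues (Ψ : C(K, ℝ) →L[ℝ] ℝ) (u : K → NNReal) : Set ℝ :=
  {r | ∃ v : C(K, ℝ), (∀ x, |v x| ≤ u x) ∧ Ψ v = r}

lemma zero_mem_orderIntervalValues (Ψ : C(K, ℝ) →L[ℝ] ℝ) (u : K → NNReal) :
    0 ∈ orderIntervalValues Ψ u :=
  ⟨0, fun x => by simp, map_zero Ψ⟩

/-- The total variation of the functional `Ψ`, as a function on nonnegative functions. -/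
noncomputable def variation (Ψ : C(K, ℝ) →L[ℝ] ℝ) (u : K → NNReal) : ℝ :=
  sSup (orderIntervalValues Ψ u)

lemma variation_le (Ψ : C(K, ℝ) →L[ℝ] ℝ) {u : K → NNReal} {a : ℝ}
    (h : ∀ v : C(K, ℝ), (∀ x, |v x| ≤ u x) → Ψ v ≤ a) : variation Ψ u ≤ a := by
  refine csSup_le ⟨0, zero_mem_orderIntervalValues Ψ u⟩ ?_
  rintro _ ⟨v, hv, rfl⟩
  exact h v hv

variable [CompactSpace K]

lemma bddAbove_orderIntervalValues (Ψ : C(K, ℝ) →L[ℝ] ℝ) {u : K → NNReal}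
    (hu : Continuous u) : BddAbove (orderIntervalValues Ψ u) := by
  obtain ⟨C, hC⟩ := (isCompact_range hu).bddAbove
  refine ⟨‖Ψ‖ * C, ?_⟩
  rintro _ ⟨v, hv, rfl⟩
  refine (le_abs_self _).trans ((Ψ.le_opNorm v).trans ?_)
  gcongr
  exact (ContinuousMap.norm_le _ C.2).2 fun x =>
    (hv x).trans (NNReal.coe_le_coe.2 (hC ⟨x, rfl⟩))

lemma le_variation (Ψ : C(K, ℝ) →L[ℝ] ℝ) {u : K → NNReal} (hu : Continuous u)
    {v : C(K, ℝ)} (hv : ∀ x, |v x| ≤ u x) : Ψ v ≤ variation Ψ u :=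
  le_csSup (bddAbove_orderIntervalValues Ψ hu) ⟨v, hv, rfl⟩

lemma variation_nonneg (Ψ : C(K, ℝ) →L[ℝ] ℝ) {u : K → NNReal} (hu : Continuous u) :
    0 ≤ variation Ψ u :=
  le_csSup (bddAbove_orderIntervalValues Ψ hu) (zero_mem_orderIntervalValues Ψ u)

lemma variation_add (Ψ : C(K, ℝ) →L[ℝ] ℝ) {u w : K → NNReal} (hu : Continuous u)
    (hw : Continuous w) : variation Ψ (u + w) = variation Ψ u + variation Ψ w := by
  apply le_antisymm
  · refine variation_le Ψ fun v hv => ?_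
    let v₁ : C(K, ℝ) := ⟨fun x => max (-(u x : ℝ)) (min (v x) (u x)), by fun_prop⟩
    have h₁ : ∀ x, |v₁ x| ≤ u x := fun x => by
      have := (u x).2
      exact abs_le.2 ⟨le_max_left _ _, max_le (by linarith) (min_le_right _ _)⟩
    have h₂ : ∀ x, |(v - v₁) x| ≤ w x := fun x => by
      have h := hv x
      have hu0 : (0 : ℝ) ≤ u x := (u x).2
      have hw0 : (0 : ℝ) ≤ w x := (w x).2
      simp only [Pi.add_apply, NNReal.coe_add, abs_le] at h
      change |v x - max (-(u x : ℝ)) (min (v x) (u x))| ≤ w x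
      rw [abs_le]
      grind
    have hsplit : Ψ v = Ψ v₁ + Ψ (v - v₁) := by rw [← map_add]; simp
    rw [hsplit]
    exact add_le_add (le_variation Ψ hu h₁) (le_variation Ψ hw h₂)
  · rw [← le_sub_iff_add_le]
    refine variation_le Ψ fun v hv => ?_
    rw [le_sub_comm]
    refine variation_le Ψ fun v' hv' => ?_
    rw [le_sub_iff_add_le, ← map_add]
    refine le_variation Ψ (hu.add hw) fun x => ?_
    have := abs_add_le (v' x) (v x)
    have := hv x
    have := hv' x
    simp only [ContinuousMap.add_apply, Pi.add_apply, NNReal.coe_add]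
    linarith

lemma mul_variation_le (Ψ : C(K, ℝ) →L[ℝ] ℝ) (c : NNReal) {u : K → NNReal}
    (hu : Continuous u) : c * variation Ψ u ≤ variation Ψ (c • u) := by
  rcases eq_or_ne c 0 with rfl | hc
  · simpa using variation_nonneg Ψ (u := (0 : NNReal) • u) (by fun_prop)
  have hc' : (0 : ℝ) < c := by positivity
  rw [← le_div_iff₀' hc']
  refine variation_le Ψ fun v hv => ?_
  rw [le_div_iff₀' hc', ← smul_eq_mul, ← map_smul]
  refine le_variation Ψ (by fun_prop) fun x => ?_
  simpa [abs_mul] using mul_le_mul_of_nonneg_left (hv x) hc'.le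

lemma variation_smul (Ψ : C(K, ℝ) →L[ℝ] ℝ) (c : NNReal) {u : K → NNReal}
    (hu : Continuous u) : variation Ψ (c • u) = c * variation Ψ u := by
  refine le_antisymm ?_ (mul_variation_le Ψ c hu)
  rcases eq_or_ne c 0 with rfl | hc
  · refine variation_le Ψ fun v hv => ?_
    have : v = 0 := by
      ext x
      simpa using hv x
    simp [this]
  · have h := mul_variation_le Ψ c⁻¹ (u := c • u) (by fun_prop)
    rw [smul_smul, inv_mul_cancel₀ hc, one_smul, NNReal.coe_inv] at h
    have hc' : (0 : ℝ) < c := by positivity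
    rwa [inv_mul_le_iff₀ hc'] at h

open scoped CompactlySupported in
/-- The total variation of `Ψ` as a positive linear functional. -/
noncomputable def variationLinearMap (Ψ : C(K, ℝ) →L[ℝ] ℝ) :
    C_c(K, NNReal) →ₗ[NNReal] NNReal where
  toFun u := ⟨variation Ψ u, variation_nonneg Ψ (map_continuous u)⟩
  map_add' u w := NNReal.eq (variation_add Ψ (map_continuous u) (map_continuous w))
  map_smul' c u := NNReal.eq (variation_smul Ψ c (map_continuous u))

/-- Every continuous functional on `C(K, ℝ)` is dominated by integration against a finite
measure. -/
lemma exists_finiteMeasure_abs_le_integral [T2Space K] [MeasurableSpace K] [BorelSpace K]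
    (Ψ : C(K, ℝ) →L[ℝ] ℝ) :
    ∃ μ : Measure K, IsFiniteMeasure μ ∧ ∀ v : C(K, ℝ), |Ψ v| ≤ ∫ x, |v x| ∂μ := by
  refine ⟨NNRealRMK.rieszMeasure (variationLinearMap Ψ), inferInstance, fun v => ?_⟩
  let u : CompactlySupportedContinuousMap K NNReal :=
    ⟨⟨fun x => ‖v x‖₊, by fun_prop⟩, HasCompactSupport.of_compactSpace _⟩
  have hu : ∫ x, |v x| ∂(NNRealRMK.rieszMeasure (variationLinearMap Ψ)) = variation Ψ u :=
    NNRealRMK.integral_rieszMeasure (variationLinearMap Ψ) u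
  rw [hu, abs_le']
  refine ⟨le_variation Ψ (map_continuous u) fun x => le_rfl, ?_⟩
  rw [← map_neg]
  exact le_variation Ψ (map_continuous u) fun x => (abs_neg (v x)).le

/-- In `C(K, ℝ)` with `K` compact Hausdorff, bounded pointwise convergence of sequences implies
weak convergence. -/
lemma tendsto_apply_of_tendsto_pointwise [T2Space K] (Ψ : C(K, ℝ) →L[ℝ] ℝ)
    {h : ℕ → C(K, ℝ)} {h₀ : C(K, ℝ)} {M : ℝ} (hM : ∀ n x, |h n x| ≤ M)
    (hlim : ∀ x, Tendsto (fun n => h n x) atTop (𝓝 (h₀ x))) :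
    Tendsto (fun n => Ψ (h n)) atTop (𝓝 (Ψ h₀)) := by
  borelize K
  obtain ⟨μ, _, hμ⟩ := exists_finiteMeasure_abs_le_integral Ψ
  have hM₀ : ∀ x, |h₀ x| ≤ M := fun x =>
    le_of_tendsto (hlim x).abs (Eventually.of_forall fun n => hM n x)
  have hint : Tendsto (fun n => ∫ x, |(h n - h₀) x| ∂μ) atTop (𝓝 (∫ _, (0 : ℝ) ∂μ)) := by
    refine tendsto_integral_of_dominated_convergence (fun _ => M + M) (fun n => ?_)
      (integrable_const _) (fun n => ae_of_all _ fun x => ?_) (ae_of_all _ fun x => ?_)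
    · exact (map_continuous (h n - h₀)).abs.aestronglyMeasurable
    · rw [Real.norm_eq_abs, abs_abs]
      exact (abs_sub _ _).trans (add_le_add (hM n x) (hM₀ x))
    · simpa using ((hlim x).sub_const (h₀ x)).abs
  rw [integral_zero] at hint
  rw [tendsto_iff_norm_sub_tendsto_zero]
  refine squeeze_zero (fun _ => norm_nonneg _) (fun n => ?_) hint
  rw [← map_sub]
  exact hμ _

end ContinuousMap

namespace BoundedContinuousFunction

variable {X : Type*} [TopologicalSpace X]

lemma exists_stoneCech_extension (h : BoundedContinuousFunction X ℝ) :
    ∃ e : C(StoneCech X, ℝ), (∀ x, e (stoneCechUnit x) = h x) ∧ ∀ p, |e p| ≤ ‖h‖ := by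
  have hmem : ∀ x, h x ∈ Set.Icc (-‖h‖) ‖h‖ := fun x => abs_le.1 (h.norm_coe_le_norm x)
  have hc : Continuous fun x => (⟨h x, hmem x⟩ : Set.Icc (-‖h‖) ‖h‖) := by fun_prop
  refine ⟨⟨fun p => (stoneCechExtend hc p).1,
    continuous_subtype_val.comp (continuous_stoneCechExtend hc)⟩, fun x => ?_, fun p => ?_⟩
  · simp [stoneCechExtend_stoneCechUnit]
  · exact abs_le.2 (stoneCechExtend hc p).2

/-- The continuous extension of a bounded continuous function to the Stone–Čech
compactification. -/
noncomputable def stoneCech (h : BoundedContinuousFunction X ℝ) : C(StoneCech X, ℝ) :=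
  h.exists_stoneCech_extension.choose

lemma stoneCech_stoneCechUnit (h : BoundedContinuousFunction X ℝ) (x : X) :
    h.stoneCech (stoneCechUnit x) = h x :=
  h.exists_stoneCech_extension.choose_spec.1 x

lemma abs_stoneCech_le (h : BoundedContinuousFunction X ℝ) (p : StoneCech X) :
    |h.stoneCech p| ≤ ‖h‖ :=
  h.exists_stoneCech_extension.choose_spec.2 p

lemma stoneCech_eq {h : BoundedContinuousFunction X ℝ} {e : C(StoneCech X, ℝ)}
    (he : ∀ x, e (stoneCechUnit x) = h x) : h.stoneCech = e :=
  DFunLike.coe_injective <| denseRange_stoneCechUnit.equalizer (map_continuous _)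
    (map_continuous e) (funext fun x => (h.stoneCech_stoneCechUnit x).trans (he x).symm)

lemma stoneCech_mul (h k : BoundedContinuousFunction X ℝ) :
    (h * k).stoneCech = h.stoneCech * k.stoneCech :=
  stoneCech_eq fun x => by simp [stoneCech_stoneCechUnit]

/-- Evaluation of the Stone–Čech extension at a point, as a continuous linear functional. -/
noncomputable def stoneCechEval (p : StoneCech X) : BoundedContinuousFunction X ℝ →L[ℝ] ℝ :=
  LinearMap.mkContinuous
    { toFun := fun h => h.stoneCech p
      map_add' := fun h k => by
        rw [stoneCech_eq (h := h + k) (e := h.stoneCech + k.stoneCech) fun x => by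
          simp [stoneCech_stoneCechUnit]]
        rfl
      map_smul' := fun c h => by
        rw [stoneCech_eq (h := c • h) (e := c • h.stoneCech) fun x => by
          simp [stoneCech_stoneCechUnit]]
        rfl }
    1 fun h => by simpa using h.abs_stoneCech_le p

/-- Restriction of continuous functions from the Stone–Čech compactification. -/
noncomputable def stoneCechRestrict (X : Type*) [TopologicalSpace X] :
    C(StoneCech X, ℝ) →L[ℝ] BoundedContinuousFunction X ℝ :=
  LinearMap.mkContinuous
    { toFun := fun e =>
        (mkOfCompact e).compContinuous ⟨stoneCechUnit, continuous_stoneCechUnit⟩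
      map_add' := fun _ _ => rfl
      map_smul' := fun _ _ => rfl }
    1 fun e => by
      rw [one_mul]
      exact (norm_le (norm_nonneg e)).2 fun x => e.norm_coe_le_norm _

lemma stoneCechRestrict_stoneCech (h : BoundedContinuousFunction X ℝ) :
    stoneCechRestrict X h.stoneCech = h :=
  ext fun x => h.stoneCech_stoneCechUnit x

/-- The product of two bounded weakly convergent sequences of bounded continuous functions
converges weakly to the product of the limits. -/
lemma tendsto_apply_mul {a b : ℕ → BoundedContinuousFunction X ℝ}
    {a₀ b₀ : BoundedContinuousFunction X ℝ} {A B : ℝ} (hA : ∀ n, ‖a n‖ ≤ A)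
    (hB : ∀ n, ‖b n‖ ≤ B)
    (ha : ∀ Φ : BoundedContinuousFunction X ℝ →L[ℝ] ℝ,
      Tendsto (fun n => Φ (a n)) atTop (𝓝 (Φ a₀)))
    (hb : ∀ Φ : BoundedContinuousFunction X ℝ →L[ℝ] ℝ,
      Tendsto (fun n => Φ (b n)) atTop (𝓝 (Φ b₀)))
    (Φ : BoundedContinuousFunction X ℝ →L[ℝ] ℝ) :
    Tendsto (fun n => Φ (a n * b n)) atTop (𝓝 (Φ (a₀ * b₀))) := by
  have key := ContinuousMap.tendsto_apply_of_tendsto_pointwise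
    (Φ.comp (stoneCechRestrict X)) (h := fun n => (a n * b n).stoneCech)
    (h₀ := (a₀ * b₀).stoneCech) (M := A * B) (fun n p => ?_) (fun p => ?_)
  · simpa only [ContinuousLinearMap.comp_apply, stoneCechRestrict_stoneCech] using key
  · refine (abs_stoneCech_le _ p).trans ((norm_mul_le _ _).trans ?_)
    exact mul_le_mul (hA n) (hB n) (norm_nonneg _) ((norm_nonneg _).trans (hA n))
  · simp only [stoneCech_mul]
    exact (ha (stoneCechEval p)).mul (hb (stoneCechEval p))

end BoundedContinuousFunction

lemma norm_translateBCF_le {d : ℕ}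
    (f : BoundedContinuousFunction (EuclideanSpace ℝ (Fin d)) ℝ)
    (l : EuclideanSpace ℝ (Fin d)) : ‖translateBCF f l‖ ≤ ‖f‖ :=
  (BoundedContinuousFunction.norm_le (norm_nonneg f)).2 fun x => f.norm_coe_le_norm (x + l)

/-- The pointwise product of two weakly almost periodic functions is weakly almost periodic. -/
theorem isWAP_mul {d : ℕ}
    (f g : BoundedContinuousFunction (EuclideanSpace ℝ (Fin d)) ℝ)
    (hf : IsWAP f) (hg : IsWAP g) : IsWAP (f * g) := by
  intro lam
  obtain ⟨φ, f₀, hφ, hf₀⟩ := hf lam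
  obtain ⟨ψ, g₀, hψ, hg₀⟩ := hg (lam ∘ φ)
  exact ⟨φ ∘ ψ, f₀ * g₀, hφ.comp hψ, BoundedContinuousFunction.tendsto_apply_mul
    (fun n => norm_translateBCF_le f (lam (φ (ψ n))))
    (fun n => norm_translateBCF_le g (lam (φ (ψ n))))
    (fun Φ => (hf₀ Φ).comp hψ.tendsto_atTop) hg₀⟩
end

section
/- Every weakly almost periodic function possesses a mean value, independent of the center of the averaging balls: if f ∈ WAP(ℝ^d), then there exists a constant c ∈ ℝ such that for every ξ ∈ ℝ^d, the averages (1/|B(ξ,L)|) ∫_{B(ξ,L)} f(y) dy converge to c as L → ∞, where B(ξ,L) is the Euclidean ball of center ξ and radius L and |·| denotes Lebesgue measure. -/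
open MeasureTheory Filter Topology

open Metric ProbabilityTheory BoundedContinuousFunction

/-- A dominated convergence theorem for weak limits of probability measures: if a uniformly bounded
sequence of functions `h j` converges to `b` along every sequential limit of points, then the limits
of its integrals against a sequence of probability measures can only be `b`. -/
theorem eq_of_tendsto_integral_of_sequential_limits {X : Type*} [MeasurableSpace X]
    {h : ℕ → X → ℝ} (hm : ∀ j, Measurable (h j)) {C : ℝ} (hC : ∀ j x, |h j x| ≤ C)
    {P : ℕ → Measure X} [∀ i, IsProbabilityMeasure (P i)] {a b : ℝ}
    (ha : ∀ j, Tendsto (fun i => ∫ x, h j x ∂P i) atTop (𝓝 a))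
    (hb : ∀ (x : ℕ → X) (q : ℕ → ℝ), (∀ j, Tendsto (fun n => h j (x n)) atTop (𝓝 (q j))) →
      Tendsto q atTop (𝓝 b)) : a = b := by
  set u : X → ℕ → ℝ := fun x j => h j x
  set K : Set (ℕ → ℝ) := closure (Set.range u)
  have hKb : K ⊆ Set.univ.pi fun _ => Set.Icc (-C) C := by
    refine closure_minimal ?_ (isClosed_set_pi fun _ _ => isClosed_Icc)
    rintro _ ⟨x, rfl⟩ j -
    exact abs_le.1 (hC j x)
  have hKc : IsCompact K :=
    (isCompact_univ_pi fun _ => isCompact_Icc).of_isClosed_subset isClosed_closure hKb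
  have : CompactSpace K := isCompact_iff_compactSpace.1 hKc
  have hlim : ∀ q : K, Tendsto (fun j => (q : ℕ → ℝ) j) atTop (𝓝 b) := by
    rintro ⟨q, hq⟩
    obtain ⟨y, hy, hyq⟩ := mem_closure_iff_seq_limit.1 hq
    choose x hx using hy
    refine hb x q fun j => ?_
    have := (tendsto_pi_nhds.1 hyq) j
    simpa only [← hx] using this
  let v : X → K := fun x => ⟨u x, subset_closure ⟨x, rfl⟩⟩
  have hv : Measurable v := (measurable_pi_lambda _ hm).subtype_mk
  let Q : ℕ → ProbabilityMeasure K := fun i =>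
    ⟨(P i).map v, Measure.isProbabilityMeasure_map hv.aemeasurable⟩
  obtain ⟨μ, -, hμ⟩ := isCompact_univ.ultrafilter_le_nhds
    ((hyperfilter ℕ).map Q) (by simp)
  have hμ' : Tendsto Q (hyperfilter ℕ) (𝓝 μ) := hμ
  rw [ProbabilityMeasure.tendsto_iff_forall_integral_tendsto] at hμ'
  have hint : ∀ j, ∫ q : K, (q : ℕ → ℝ) j ∂(μ : Measure K) = a := by
    intro j
    let F : K →ᵇ ℝ := BoundedContinuousFunction.mkOfCompact
      ⟨fun q => (q : ℕ → ℝ) j, (continuous_apply j).comp continuous_subtype_val⟩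
    refine tendsto_nhds_unique (hμ' F) ?_
    have h1 := (ha j).mono_left (Nat.hyperfilter_le_atTop)
    refine h1.congr fun i => ?_
    change _ = ∫ q, F q ∂((P i).map v)
    rw [integral_map hv.aemeasurable F.continuous.aestronglyMeasurable]
    rfl
  have hdct : Tendsto (fun j => ∫ q : K, (q : ℕ → ℝ) j ∂(μ : Measure K)) atTop
      (𝓝 (∫ _ : K, b ∂(μ : Measure K))) := by
    refine tendsto_integral_of_dominated_convergence (fun _ => C) (fun j => ?_)
      (integrable_const _) (fun j => ?_) (ae_of_all _ hlim)
    · exact ((continuous_apply j).comp continuous_subtype_val).aestronglyMeasurable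
    · exact ae_of_all _ fun q => abs_le.2 (hKb q.2 j trivial)
  simp only [hint, integral_const, probReal_univ, one_smul] at hdct
  exact tendsto_nhds_unique tendsto_const_nhds hdct

section BallAverages

variable {d : ℕ}

local notation "𝔼" => EuclideanSpace ℝ (Fin d)

theorem isProbabilityMeasure_cond_ball {L : ℝ} (hL : 0 < L) :
    IsProbabilityMeasure ((volume : Measure 𝔼)[|ball 0 L]) :=
  cond_isProbabilityMeasure_of_finite (measure_ball_pos _ _ hL).ne' measure_ball_lt_top.ne

theorem setAverage_ball_eq_integral_cond (g : 𝔼 → ℝ) (ξ : 𝔼) (L : ℝ) :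
    ⨍ y in ball ξ L, g y = ∫ y, g (y + ξ) ∂(volume : Measure 𝔼)[|ball 0 L] := by
  rw [setAverage_eq', ProbabilityTheory.cond, integral_smul_measure, integral_smul_measure,
    Measure.addHaar_ball_center]
  congr 1
  rw [← (measurePreserving_add_right volume ξ).setIntegral_preimage_emb
    (measurableEmbedding_addRight ξ) g (ball ξ L)]
  congr 2
  ext y
  simp

theorem abs_integral_cond_ball_translate_sub_le (g : 𝔼 →ᵇ ℝ) {L r : ℝ} (hL : 0 < L) {ξ : 𝔼}
    (hξ : ‖ξ‖ ≤ r) :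
    |∫ y, g (y + ξ) ∂(volume : Measure 𝔼)[|ball 0 L] - ∫ y, g y ∂(volume : Measure 𝔼)[|ball 0 L]| ≤
      2 * ‖g‖ * (((L + r) / L) ^ d - 1) := by
  have hr : 0 ≤ r := (norm_nonneg ξ).trans hξ
  have key : ∀ η : 𝔼, ‖η‖ ≤ r →
      |(∫ y in ball 0 (L + r), g y) - ∫ y in ball η L, g y| ≤
        ‖g‖ * (volume.real (ball (0 : 𝔼) (L + r)) - volume.real (ball (0 : 𝔼) L)) := by
    intro η hη
    have hsub : ball η L ⊆ ball (0 : 𝔼) (L + r) :=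
      ball_subset_ball' (by rw [dist_zero_right]; linarith)
    have hi : IntegrableOn g (ball 0 (L + r)) :=
      Measure.integrableOn_of_bounded measure_ball_lt_top.ne g.continuous.aestronglyMeasurable
        (ae_of_all _ g.norm_coe_le_norm)
    rw [← setIntegral_sdiff measurableSet_ball hi hsub, ← Real.norm_eq_abs,
      ← Measure.addHaar_real_ball_center volume η L,
      ← measureReal_sdiff hsub measurableSet_ball]
    exact norm_setIntegral_le_of_norm_le_const
      ((measure_mono Set.sdiff_subset).trans_lt measure_ball_lt_top)
      (fun y _ => g.norm_coe_le_norm y)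
  have hvol : 0 < volume.real (ball (0 : 𝔼) L) :=
    ENNReal.toReal_pos (measure_ball_pos _ _ hL).ne' measure_ball_lt_top.ne
  have hratio : volume.real (ball (0 : 𝔼) (L + r)) =
      ((L + r) / L) ^ d * volume.real (ball (0 : 𝔼) L) := by
    have h := Measure.addHaar_ball_mul_of_pos (volume : Measure 𝔼) 0
      (show 0 < (L + r) / L by positivity) L
    rw [div_mul_cancel₀ _ hL.ne'] at h
    rw [measureReal_def, h, ENNReal.toReal_mul, finrank_euclideanSpace_fin,
      ENNReal.toReal_ofReal (by positivity), measureReal_def]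
  have h1 := key ξ hξ
  have h2 := key 0 (by simpa using hr)
  have h0 := setAverage_ball_eq_integral_cond g 0 L
  simp only [add_zero] at h0
  rw [← setAverage_ball_eq_integral_cond, ← h0, setAverage_eq, setAverage_eq,
    Measure.addHaar_real_ball_center volume ξ L, ← smul_sub, smul_eq_mul, abs_mul,
    abs_of_pos (inv_pos.2 hvol), inv_mul_le_iff₀ hvol]
  rw [hratio] at h1 h2
  rw [abs_le] at *
  constructor <;> nlinarith

theorem tendsto_ball_growth (d : ℕ) (c r : ℝ) :
    Tendsto (fun L : ℝ => c * (((L + r) / L) ^ d - 1)) atTop (𝓝 0) := by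
  have h1 : Tendsto (fun L : ℝ => 1 + r / L) atTop (𝓝 (1 + 0)) :=
    tendsto_const_nhds.add (tendsto_const_nhds.div_atTop tendsto_id)
  have h2 : Tendsto (fun L : ℝ => (L + r) / L) atTop (𝓝 (1 + 0)) := by
    refine h1.congr' ?_
    filter_upwards [eventually_gt_atTop 0] with L hL
    field_simp
  simpa using ((h2.pow d).sub_const 1).const_mul c

theorem tendsto_integral_cond_ball_translate_sub (g : 𝔼 →ᵇ ℝ) (ξ : 𝔼) :
    Tendsto (fun L : ℝ => ∫ y, g (y + ξ) ∂(volume : Measure 𝔼)[|ball 0 L] -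
      ∫ y, g y ∂(volume : Measure 𝔼)[|ball 0 L]) atTop (𝓝 0) := by
  refine squeeze_zero_norm' ?_ (tendsto_ball_growth d (2 * ‖g‖) ‖ξ‖)
  filter_upwards [eventually_gt_atTop 0] with L hL
  exact abs_integral_cond_ball_translate_sub_le g hL le_rfl

theorem stronglyMeasurable_integral_cond_ball_translate (g : 𝔼 →ᵇ ℝ) (M : ℝ) :
    StronglyMeasurable fun x => ∫ y, g (y + x) ∂(volume : Measure 𝔼)[|ball 0 M] := by
  refine StronglyMeasurable.integral_prod_right' (f := fun p : 𝔼 × 𝔼 => g (p.2 + p.1)) ?_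
  exact (g.continuous.comp (continuous_snd.add continuous_fst)).stronglyMeasurable

theorem abs_integral_cond_ball_le (g : 𝔼 →ᵇ ℝ) {M : ℝ} (hM : 0 < M) :
    |∫ y, g y ∂(volume : Measure 𝔼)[|ball 0 M]| ≤ ‖g‖ := by
  have := isProbabilityMeasure_cond_ball (d := d) hM
  simpa using norm_integral_le_of_norm_le_const (ae_of_all _ g.norm_coe_le_norm)
    (μ := (volume : Measure 𝔼)[|ball 0 M])

theorem norm_translateBCF_le_s3 (f : 𝔼 →ᵇ ℝ) (x : 𝔼) : ‖translateBCF f x‖ ≤ ‖f‖ :=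
  (norm_le (norm_nonneg _)).2 fun y => f.norm_coe_le_norm (y + x)

theorem tendsto_integral_cond_ball_integral_sub (g : 𝔼 →ᵇ ℝ) {M : ℝ} (hM : 0 < M) :
    Tendsto (fun L : ℝ => ∫ x, ∫ y, g (y + x) ∂(volume : Measure 𝔼)[|ball 0 M]
      ∂(volume : Measure 𝔼)[|ball 0 L] - ∫ y, g y ∂(volume : Measure 𝔼)[|ball 0 L])
      atTop (𝓝 0) := by
  refine squeeze_zero_norm' ?_ (tendsto_ball_growth d (2 * ‖g‖) M)
  filter_upwards [eventually_gt_atTop 0] with L hL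
  have := isProbabilityMeasure_cond_ball (d := d) hM
  have := isProbabilityMeasure_cond_ball (d := d) hL
  have hint : Integrable (fun p : 𝔼 × 𝔼 => g (p.2 + p.1))
      (((volume : Measure 𝔼)[|ball 0 L]).prod ((volume : Measure 𝔼)[|ball 0 M])) :=
    .of_bound (g.continuous.comp (continuous_snd.add continuous_fst)).aestronglyMeasurable ‖g‖
      (ae_of_all _ fun p => g.norm_coe_le_norm _)
  rw [integral_integral_swap hint]
  have hint' := hint.integral_prod_right
  have hsub : ∫ y, ∫ x, g (y + x) ∂(volume : Measure 𝔼)[|ball 0 L]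
        ∂(volume : Measure 𝔼)[|ball 0 M] - ∫ y, g y ∂(volume : Measure 𝔼)[|ball 0 L] =
      ∫ y, (∫ x, g (y + x) ∂(volume : Measure 𝔼)[|ball 0 L] -
        ∫ y, g y ∂(volume : Measure 𝔼)[|ball 0 L]) ∂(volume : Measure 𝔼)[|ball 0 M] := by
    rw [integral_sub hint' (integrable_const _)]
    simp
  rw [hsub]
  refine (norm_integral_le_of_norm_le_const (C := 2 * ‖g‖ * (((L + M) / L) ^ d - 1)) ?_).trans
    (by simp)
  filter_upwards [ae_cond_mem measurableSet_ball] with y hy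
  simp_rw [add_comm y]
  exact abs_integral_cond_ball_translate_sub_le g hL (mem_ball_zero_iff.1 hy).le

/-- Averaging over a ball of positive radius, as a continuous linear functional. -/
noncomputable def ballAverageCLM {M : ℝ} (hM : 0 < M) : (𝔼 →ᵇ ℝ) →L[ℝ] ℝ :=
  haveI := isProbabilityMeasure_cond_ball (d := d) hM
  LinearMap.mkContinuous
    { toFun := fun g => ∫ y, g y ∂(volume : Measure 𝔼)[|ball 0 M]
      map_add' := fun g h => integral_add (g.integrable _) (h.integrable _)
      map_smul' := fun c g => integral_const_mul c g }
    1 fun g => by simpa using abs_integral_cond_ball_le g hM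

theorem ballAverageCLM_apply {M : ℝ} (hM : 0 < M) (g : 𝔼 →ᵇ ℝ) :
    ballAverageCLM hM g = ∫ y, g y ∂(volume : Measure 𝔼)[|ball 0 M] := rfl

theorem norm_ballAverageCLM_le {M : ℝ} (hM : 0 < M) : ‖ballAverageCLM (d := d) hM‖ ≤ 1 :=
  LinearMap.mkContinuous_norm_le _ zero_le_one _

/-- Ball averages along a fixed sequence of radii pass to weak limits of translates. -/
theorem tendsto_integral_cond_ball_of_weak_limit {f g : 𝔼 →ᵇ ℝ} {x : ℕ → 𝔼}
    (hg : ∀ Φ : (𝔼 →ᵇ ℝ) →L[ℝ] ℝ, Tendsto (fun n => Φ (translateBCF f (x n))) atTop (𝓝 (Φ g)))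
    {M : ℕ → ℝ} (hM : ∀ j, 0 < M j) (hMtop : Tendsto M atTop atTop) {b : ℝ}
    (hb : Tendsto (fun j => ∫ y, f y ∂(volume : Measure 𝔼)[|ball 0 (M j)]) atTop (𝓝 b)) :
    Tendsto (fun j => ∫ y, g y ∂(volume : Measure 𝔼)[|ball 0 (M j)]) atTop (𝓝 b) := by
  rw [tendsto_iff_ultrafilter]
  intro V hV
  obtain ⟨Ψ, -, hΨ⟩ :=
      (WeakDual.isCompact_closedBall (𝕜 := ℝ) (E := 𝔼 →ᵇ ℝ) 0 1).ultrafilter_le_nhds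
    (V.map fun j => StrongDual.toWeakDual (ballAverageCLM (hM j))) (by
      rw [le_principal_iff]
      exact Filter.mem_map.2 (Filter.Eventually.of_forall fun j =>
        mem_closedBall_zero_iff.2 (norm_ballAverageCLM_le (hM j))))
  have hΨ' : ∀ h : 𝔼 →ᵇ ℝ,
      Tendsto (fun j => ∫ y, h y ∂(volume : Measure 𝔼)[|ball 0 (M j)]) V (𝓝 (Ψ h)) := fun h =>
    ((WeakDual.eval_continuous h).tendsto Ψ).comp hΨ
  have htrans : ∀ z, Ψ (translateBCF f z) = b := by
    intro z
    refine tendsto_nhds_unique (hΨ' _) ?_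
    have h := (((tendsto_integral_cond_ball_translate_sub f z).comp hMtop).add hb).mono_left hV
    rw [zero_add] at h
    exact h.congr fun j => sub_add_cancel _ _
  have hΨg : Ψ g = b := by
    have h := hg (WeakDual.toStrongDual Ψ)
    exact tendsto_nhds_unique h (tendsto_const_nhds.congr fun n => (htrans _).symm)
  exact hΨg ▸ hΨ' g

theorem IsWAP.eq_of_tendsto_integral_cond_ball {f : 𝔼 →ᵇ ℝ} (hf : IsWAP f) {L M : ℕ → ℝ}
    (hL : ∀ i, 0 < L i) (hLtop : Tendsto L atTop atTop)
    (hM : ∀ j, 0 < M j) (hMtop : Tendsto M atTop atTop) {a b : ℝ}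
    (ha : Tendsto (fun i => ∫ y, f y ∂(volume : Measure 𝔼)[|ball 0 (L i)]) atTop (𝓝 a))
    (hb : Tendsto (fun j => ∫ y, f y ∂(volume : Measure 𝔼)[|ball 0 (M j)]) atTop (𝓝 b)) :
    a = b := by
  have := fun i => isProbabilityMeasure_cond_ball (d := d) (hL i)
  refine eq_of_tendsto_integral_of_sequential_limits
    (h := fun j x => ∫ y, f (y + x) ∂(volume : Measure 𝔼)[|ball 0 (M j)])
    (P := fun i => (volume : Measure 𝔼)[|ball 0 (L i)]) (C := ‖f‖)
    (fun j => (stronglyMeasurable_integral_cond_ball_translate f (M j)).measurable)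
    (fun j x => (abs_integral_cond_ball_le (translateBCF f x) (hM j)).trans
      (norm_translateBCF_le_s3 f x)) (fun j => ?_) (fun x q hq => ?_)
  · have h := ((tendsto_integral_cond_ball_integral_sub f (hM j)).comp hLtop).add ha
    rw [zero_add] at h
    exact h.congr fun i => sub_add_cancel _ _
  · obtain ⟨φ, g, hφ, hg⟩ := hf x
    refine (tendsto_integral_cond_ball_of_weak_limit hg hM hMtop hb).congr fun j => ?_
    exact tendsto_nhds_unique (hg (ballAverageCLM (hM j))) ((hq j).comp hφ.tendsto_atTop)

end BallAverages

/-- Every weakly almost periodic function possesses a mean value, independent of the center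
of the averaging balls: the averages over `B(ξ, L)` converge, as `L → ∞`, to a constant `c`
not depending on `ξ`. -/
theorem wap_hasMeanValue {d : ℕ}
    (f : BoundedContinuousFunction (EuclideanSpace ℝ (Fin d)) ℝ)
    (hf : IsWAP f) :
    ∃ c : ℝ, ∀ ξ : EuclideanSpace ℝ (Fin d),
      Tendsto (fun L : ℝ => ⨍ y in Metric.ball ξ L, f y) atTop (𝓝 c) := by
  set A : ℝ → ℝ := fun L =>
    ∫ y, f y ∂(volume : Measure (EuclideanSpace ℝ (Fin d)))[|ball 0 L] with hA
  have hsub : ∀ N : ℕ → ℝ, Tendsto N atTop atTop → ∃ (c : ℝ) (φ : ℕ → ℕ),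
      StrictMono φ ∧ (∀ n, 0 < N (φ n)) ∧ Tendsto (fun n => A (N (φ n))) atTop (𝓝 c) := by
    intro N hN
    obtain ⟨φ, hφ, hpos⟩ := extraction_of_eventually_atTop (hN.eventually_gt_atTop 0)
    obtain ⟨c, -, ψ, hψ, hc⟩ := tendsto_subseq_of_bounded (isBounded_closedBall (x := 0) (r := ‖f‖))
      (x := fun n => A (N (φ n)))
      fun n => mem_closedBall_zero_iff.2 (abs_integral_cond_ball_le f (hpos n))
    exact ⟨c, φ ∘ ψ, hφ.comp hψ, fun n => hpos _, hc⟩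
  obtain ⟨c, φ, hφ, hpos, hc⟩ := hsub (fun n => n) tendsto_natCast_atTop_atTop
  have hAc : Tendsto A atTop (𝓝 c) := by
    refine tendsto_of_subseq_tendsto fun N hN => ?_
    obtain ⟨b, ψ, hψ, hpos', hb⟩ := hsub N hN
    refine ⟨ψ, ?_⟩
    rwa [hf.eq_of_tendsto_integral_cond_ball hpos
      (tendsto_natCast_atTop_atTop.comp hφ.tendsto_atTop) hpos' (hN.comp hψ.tendsto_atTop) hc hb]
  refine ⟨c, fun ξ => ?_⟩
  have h := (tendsto_integral_cond_ball_translate_sub f ξ).add hAc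
  rw [zero_add] at h
  refine h.congr fun L => ?_
  rw [setAverage_ball_eq_integral_cond, hA, sub_add_cancel]
end

section
/- Mean-value convolution of an almost periodic function with a weakly almost periodic function is almost periodic: let f ∈ AP(ℝ^d) and φ ∈ WAP(ℝ^d). Then for every x ∈ ℝ^d the mean value g(x) := lim_{R→∞} (1/|B(0,R)|) ∫_{B(0,R)} f(x−y) φ(y) dy exists, and the resulting function g : ℝ^d → ℝ is almost periodic in the Bochner sense, i.e., g ∈ AP(ℝ^d). -/
open MeasureTheory Filter Topology

/-- `f` is almost periodic in the Bochner sense: `f` is (bounded and) uniformly continuous and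
its set of translates is totally bounded in the sup norm. -/
def IsAP {d : ℕ} (f : BoundedContinuousFunction (EuclideanSpace ℝ (Fin d)) ℝ) : Prop :=
  UniformContinuous ⇑f ∧
  TotallyBounded {g : BoundedContinuousFunction (EuclideanSpace ℝ (Fin d)) ℝ |
    ∃ l : EuclideanSpace ℝ (Fin d), g = translateBCF f l}

/-- A positive functional on `C(K, ℝ)`, `K` compact, is sequentially continuous for bounded
pointwise convergence. -/
theorem tendsto_of_positive_of_bounded_pointwise {K : Type*} [TopologicalSpace K] [CompactSpace K]
    [T2Space K] (Φ : C(K, ℝ) →L[ℝ] ℝ) (hΦ : ∀ v : C(K, ℝ), 0 ≤ v → 0 ≤ Φ v)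
    (e : ℕ → C(K, ℝ)) (C : ℝ) (hC : ∀ n k, |e n k| ≤ C)
    (he : ∀ k, Tendsto (fun n => e n k) atTop (𝓝 0)) :
    Tendsto (fun n => Φ (e n)) atTop (𝓝 0) := by
  let _ : MeasurableSpace K := borel K
  have : BorelSpace K := ⟨rfl⟩
  let L : CompactlySupportedContinuousMap K ℝ →ₗ[ℝ] ℝ :=
    { toFun := fun v => Φ (v : C(K, ℝ))
      map_add' := fun v w => map_add Φ (v : C(K, ℝ)) (w : C(K, ℝ))
      map_smul' := fun c v => map_smul Φ c (v : C(K, ℝ)) }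
  let Λ := PositiveLinearMap.mk₀ L fun v hv => hΦ _ hv
  have hint : ∀ v : C(K, ℝ), ∫ x, v x ∂(RealRMK.rieszMeasure Λ) = Φ v := fun v =>
    RealRMK.integral_rieszMeasure Λ (CompactlySupportedContinuousMap.continuousMapEquiv v)
  have hlim : Tendsto (fun n => ∫ x, e n x ∂(RealRMK.rieszMeasure Λ)) atTop
      (𝓝 (∫ _, (0 : ℝ) ∂(RealRMK.rieszMeasure Λ))) :=
    tendsto_integral_of_dominated_convergence (fun _ => C)
      (fun n => (e n).continuous.aestronglyMeasurable) (integrable_const C)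
      (fun n => Eventually.of_forall (hC n)) (Eventually.of_forall he)
  simpa [hint] using hlim

/-- Continuous functions on a compact space that are uniformly bounded and converge
pointwise to zero have convex combinations that are uniformly small from above. -/
theorem exists_mem_convexHull_lt {K : Type*} [TopologicalSpace K] [CompactSpace K]
    [T2Space K] (e : ℕ → C(K, ℝ)) (C : ℝ) (hC : ∀ n k, |e n k| ≤ C)
    (he : ∀ k, Tendsto (fun n => e n k) atTop (𝓝 0)) {ε : ℝ} (hε : 0 < ε) :
    ∃ u ∈ convexHull ℝ (Set.range e), ∀ k, u k < ε := by
  by_contra! hcon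
  have hopen : IsOpen {u : C(K, ℝ) | ∀ k, u k < ε} := by
    have := ContinuousMap.isOpen_setOfPred_mapsTo (X := K) (Y := ℝ) isCompact_univ (isOpen_Iio (a := ε))
    simpa [Set.MapsTo] using this
  have hconv : Convex ℝ {u : C(K, ℝ) | ∀ k, u k < ε} := by
    intro u hu v hv a b ha hb hab k
    exact (convex_Iio ε) (hu k) (hv k) ha hb hab
  obtain ⟨Φ, s, hlt, hge⟩ := geometric_hahn_banach_open hconv hopen
    (convex_convexHull ℝ (Set.range e)) (by
      rw [Set.disjoint_left]
      intro u hu hu'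
      obtain ⟨k, hk⟩ := hcon u hu'
      exact absurd (hu k) (not_lt.2 hk))
  have hs : 0 < s := by simpa using hlt 0 fun k => by simpa using hε
  have hpos : ∀ v : C(K, ℝ), 0 ≤ v → 0 ≤ Φ v := by
    intro v hv
    by_contra! hneg
    have hv' := hlt ((s / Φ v) • v) fun k => by
      have h1 : s / Φ v ≤ 0 := div_nonpos_of_nonneg_of_nonpos hs.le hneg.le
      have h2 : (s / Φ v) * v k ≤ 0 := mul_nonpos_of_nonpos_of_nonneg h1 (hv k)
      exact lt_of_le_of_lt h2 hε
    rw [map_smul, smul_eq_mul, div_mul_cancel₀ _ hneg.ne] at hv'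
    exact lt_irrefl _ hv'
  have hlim := tendsto_of_positive_of_bounded_pointwise Φ hpos e C hC he
  exact absurd (ge_of_tendsto' hlim fun n =>
    hge _ (subset_convexHull ℝ _ ⟨n, rfl⟩)) (not_le.2 hs)

/-- A uniformly bounded sequence of functions, all of whose limits along sequences of points tend
to zero, has convex combinations that are uniformly small. -/
theorem exists_convex_combination_abs_le {X : Type*} (h : ℕ → X → ℝ) (C : ℝ)
    (hC : ∀ n x, |h n x| ≤ C)
    (hlim : ∀ (x : ℕ → X) (a : ℕ → ℝ), (∀ n, Tendsto (fun k => h n (x k)) atTop (𝓝 (a n))) →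
      Tendsto a atTop (𝓝 0)) {ε : ℝ} (hε : 0 < ε) :
    ∃ (ι : Type) (t : Finset ι) (w : ι → ℝ) (z : ι → ℕ), (∀ i ∈ t, 0 ≤ w i) ∧ ∑ i ∈ t, w i = 1 ∧
      ∀ x, |∑ i ∈ t, w i * h (z i) x| ≤ ε := by
  let H : X → ℕ → ℝ := fun x n => h n x
  let S : Set (ℕ → ℝ) := Set.univ.pi fun _ => Set.Icc (-C) C
  have hS : IsCompact S := isCompact_univ_pi fun _ => isCompact_Icc
  have hsub : closure (Set.range H) ⊆ S :=
    closure_minimal (by rintro _ ⟨x, rfl⟩ n -; exact abs_le.1 (hC n x)) hS.isClosed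
  have : CompactSpace (closure (Set.range H)) :=
    isCompact_iff_compactSpace.1 (hS.of_isClosed_subset isClosed_closure hsub)
  let e : ℕ → C(closure (Set.range H), ℝ) := fun n =>
    ⟨fun k => |k.1 n|, ((continuous_apply n).comp continuous_subtype_val).abs⟩
  obtain ⟨u, hu, hlt⟩ := exists_mem_convexHull_lt e C
    (fun n k => by
      change |(|k.1 n|)| ≤ C
      rw [abs_abs]
      exact abs_le.2 (hsub k.2 n trivial))
    (fun k => by
      obtain ⟨p, hp, hpk⟩ := mem_closure_iff_seq_limit.1 k.2
      choose x hx using hp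
      have := hlim x k.1 fun n => by
        refine ((tendsto_pi_nhds.1 hpk) n).congr fun j => ?_
        rw [← hx j]
      have habs := this.abs
      rw [abs_zero] at habs
      exact habs) hε
  rw [convexHull_eq] at hu
  obtain ⟨ι, t, w, v, hw, hsum, hv, rfl⟩ := hu
  have hv' : ∀ i, ∃ n, i ∈ t → e n = v i := fun i => by
    by_cases hi : i ∈ t
    · obtain ⟨n, hn⟩ := hv i hi
      exact ⟨n, fun _ => hn⟩
    · exact ⟨0, fun h => absurd h hi⟩
  choose z hz using hv'
  refine ⟨ι, t, w, z, hw, hsum, fun x => ?_⟩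
  have hx := hlt ⟨H x, subset_closure ⟨x, rfl⟩⟩
  rw [Finset.centerMass_eq_of_sum_1 _ _ hsum] at hx
  refine le_trans ?_ hx.le
  rw [ContinuousMap.sum_apply]
  refine (Finset.abs_sum_le_sum_abs _ _).trans (Finset.sum_le_sum fun i hi => ?_)
  rw [← hz i hi, abs_mul, abs_of_nonneg (hw i hi)]
  exact le_rfl

/-- The average over the ball of radius `R` centered at the origin, as a functional. -/
noncomputable def ballAverage (d : ℕ) (R : ℝ) :
    BoundedContinuousFunction (EuclideanSpace ℝ (Fin d)) ℝ →L[ℝ] ℝ :=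
  LinearMap.mkContinuous
    { toFun := fun u => ⨍ y in Metric.ball (0 : EuclideanSpace ℝ (Fin d)) R, u y
      map_add' := fun u v => by
        have : IsFiniteMeasure
            (volume.restrict (Metric.ball (0 : EuclideanSpace ℝ (Fin d)) R)) :=
          isFiniteMeasure_restrict.2 measure_ball_lt_top.ne
        simp only [setAverage_eq, BoundedContinuousFunction.add_apply]
        rw [integral_add (u.integrable _) (v.integrable _), smul_add]
      map_smul' := fun c u => by
        simp only [setAverage_eq, BoundedContinuousFunction.smul_apply, RingHom.id_apply]
        rw [integral_smul, smul_comm] }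
    1 fun u => by
      change ‖⨍ y in Metric.ball (0 : EuclideanSpace ℝ (Fin d)) R, u y‖ ≤ 1 * ‖u‖
      have hle := norm_setIntegral_le_of_norm_le_const
        (measure_ball_lt_top (μ := volume) (x := (0 : EuclideanSpace ℝ (Fin d))) (r := R))
        (fun y _ => u.norm_coe_le_norm y)
      rw [setAverage_eq, norm_smul, norm_inv, Real.norm_of_nonneg measureReal_nonneg, one_mul]
      refine inv_mul_le_of_le_mul₀ measureReal_nonneg (norm_nonneg u) ?_
      rwa [mul_comm]

theorem ballAverage_apply {d : ℕ} (R : ℝ)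
    (u : BoundedContinuousFunction (EuclideanSpace ℝ (Fin d)) ℝ) :
    ballAverage d R u = ⨍ y in Metric.ball (0 : EuclideanSpace ℝ (Fin d)) R, u y := rfl

theorem abs_ballAverage_le {d : ℕ} (R : ℝ)
    (u : BoundedContinuousFunction (EuclideanSpace ℝ (Fin d)) ℝ) :
    |ballAverage d R u| ≤ ‖u‖ := by
  have h : ‖ballAverage d R u‖ ≤ 1 * ‖u‖ :=
    (ballAverage d R).le_of_opNorm_le (LinearMap.mkContinuous_norm_le _ zero_le_one _) u
  rwa [one_mul] at h

theorem ballAverage_const {d : ℕ} {R : ℝ} (hR : 0 < R) (c : ℝ) :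
    ballAverage d R (BoundedContinuousFunction.const _ c) = c := by
  rw [ballAverage_apply]
  exact setAverage_const (Metric.measure_ball_pos volume _ hR).ne' measure_ball_lt_top.ne c

/-- The integrals of a bounded function over nested sets differ by at most the sup norm times the
difference of the volumes. -/
theorem abs_setIntegral_sub_setIntegral_le {d : ℕ}
    (u : BoundedContinuousFunction (EuclideanSpace ℝ (Fin d)) ℝ)
    {s t : Set (EuclideanSpace ℝ (Fin d))} (ht : MeasurableSet t) (hst : t ⊆ s)
    (hs : volume s ≠ ⊤) :
    |(∫ y in s, u y) - ∫ y in t, u y| ≤ ‖u‖ * (volume.real s - volume.real t) := by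
  have : IsFiniteMeasure (volume.restrict s) := isFiniteMeasure_restrict.2 hs
  rw [← setIntegral_sdiff ht (u.integrable (volume.restrict s)) hst,
    ← measureReal_sdiff hst ht hs]
  exact norm_setIntegral_le_of_norm_le_const
    ((measure_mono Set.sdiff_subset).trans_lt hs.lt_top) fun y _ => u.norm_coe_le_norm y

theorem volume_real_ball_eq {d : ℕ} (x : EuclideanSpace ℝ (Fin d)) {r : ℝ} (hr : 0 < r) :
    volume.real (Metric.ball x r) =
      r ^ d * volume.real (Metric.ball (0 : EuclideanSpace ℝ (Fin d)) 1) := by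
  rw [measureReal_def, Measure.addHaar_ball_of_pos _ _ hr, ENNReal.toReal_mul, measureReal_def,
    ENNReal.toReal_ofReal (by positivity), finrank_euclideanSpace_fin]

theorem abs_ballAverage_translate_sub_le {d : ℕ}
    (u : BoundedContinuousFunction (EuclideanSpace ℝ (Fin d)) ℝ)
    {R r : ℝ} (hr : 0 ≤ r) (hR : r < R) {l : EuclideanSpace ℝ (Fin d)} (hl : ‖l‖ ≤ r) :
    |ballAverage d R (translateBCF u l) - ballAverage d R u| ≤
      2 * ‖u‖ * (1 - ((R - r) / R) ^ d) := by
  have hR0 : 0 < R := hr.trans_lt hR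
  have hRr : 0 < R - r := sub_pos.2 hR
  have hshift : ∫ y in Metric.ball (0 : EuclideanSpace ℝ (Fin d)) R, translateBCF u l y =
      ∫ y in Metric.ball l R, u y := by
    have hpre : (fun y => y + l) ⁻¹' Metric.ball l R =
        Metric.ball (0 : EuclideanSpace ℝ (Fin d)) R := by
      ext y
      simp [dist_eq_norm]
    rw [← hpre]
    exact (measurePreserving_add_right volume l).setIntegral_preimage_emb
      (MeasurableEquiv.addRight l).measurableEmbedding u (Metric.ball l R)
  have h1 := abs_setIntegral_sub_setIntegral_le u
    (s := Metric.ball l R) (t := Metric.ball 0 (R - r)) measurableSet_ball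
    (Metric.ball_subset_ball' (by rw [dist_zero_left]; linarith)) measure_ball_lt_top.ne
  have h2 := abs_setIntegral_sub_setIntegral_le u
    (s := Metric.ball 0 R) (t := Metric.ball 0 (R - r)) measurableSet_ball
    (Metric.ball_subset_ball (by linarith)) measure_ball_lt_top.ne
  rw [volume_real_ball_eq _ hR0, volume_real_ball_eq _ hRr] at h1 h2
  have hV : 0 < volume.real (Metric.ball (0 : EuclideanSpace ℝ (Fin d)) 1) :=
    ENNReal.toReal_pos (Metric.measure_ball_pos volume _ one_pos).ne' measure_ball_lt_top.ne
  rw [ballAverage_apply, ballAverage_apply, setAverage_eq, setAverage_eq, hshift, ← smul_sub,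
    smul_eq_mul, abs_mul, volume_real_ball_eq _ hR0, abs_of_pos (by positivity)]
  refine inv_mul_le_of_le_mul₀ (by positivity) ?_ ?_
  · refine mul_nonneg (by positivity) (sub_nonneg.2 (pow_le_one₀ (by positivity) ?_))
    rw [div_le_one hR0]
    linarith
  · have h3 : R ^ d * ((R - r) / R) ^ d = (R - r) ^ d := by
      rw [← mul_pow, mul_div_cancel₀ _ hR0.ne']
    calc _ ≤ _ := abs_sub_le _ (∫ y in Metric.ball 0 (R - r), u y) _
      _ ≤ 2 * ‖u‖ * (R ^ d - (R - r) ^ d) *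
          volume.real (Metric.ball (0 : EuclideanSpace ℝ (Fin d)) 1) := by
        rw [abs_sub_comm (∫ y in Metric.ball 0 (R - r), u y)]
        linarith
      _ = _ := by
        rw [← h3]
        ring

theorem tendsto_translate_defect {d : ℕ} (c r : ℝ) :
    Tendsto (fun R : ℝ => c * (1 - ((R - r) / R) ^ d)) atTop (𝓝 0) := by
  have h1 : Tendsto (fun R : ℝ => (R - r) / R) atTop (𝓝 1) := by
    have h : Tendsto (fun R : ℝ => 1 - r / R) atTop (𝓝 (1 - 0)) :=
      tendsto_const_nhds.sub (tendsto_id.const_div_atTop r)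
    rw [sub_zero] at h
    refine h.congr' ?_
    filter_upwards [eventually_ne_atTop 0] with R hR
    rw [sub_div, div_self hR]
  simpa using ((h1.pow d).const_sub 1).const_mul c

theorem tendsto_ballAverage_translate_sub {d : ℕ}
    (u : BoundedContinuousFunction (EuclideanSpace ℝ (Fin d)) ℝ)
    (l : EuclideanSpace ℝ (Fin d)) :
    Tendsto (fun R => ballAverage d R (translateBCF u l - u)) atTop (𝓝 0) := by
  refine squeeze_zero_norm' ?_ (tendsto_translate_defect (d := d) (2 * ‖u‖) ‖l‖)
  filter_upwards [eventually_gt_atTop ‖l‖] with R hR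
  rw [map_sub]
  exact abs_ballAverage_translate_sub_le u (norm_nonneg l) hR le_rfl

/-- The functions whose ball averages tend to zero form a weakly sequentially closed set. -/
theorem tendsto_ballAverage_zero_of_weak_limit {d : ℕ}
    (v : ℕ → BoundedContinuousFunction (EuclideanSpace ℝ (Fin d)) ℝ)
    (g : BoundedContinuousFunction (EuclideanSpace ℝ (Fin d)) ℝ)
    (hv : ∀ k, Tendsto (fun R => ballAverage d R (v k)) atTop (𝓝 0))
    (hg : ∀ Φ : BoundedContinuousFunction (EuclideanSpace ℝ (Fin d)) ℝ →L[ℝ] ℝ,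
      Tendsto (fun k => Φ (v k)) atTop (𝓝 (Φ g))) :
    Tendsto (fun R => ballAverage d R g) atTop (𝓝 0) := by
  let S : Set (BoundedContinuousFunction (EuclideanSpace ℝ (Fin d)) ℝ) :=
    {u | Tendsto (fun R => ballAverage d R u) atTop (𝓝 0)}
  have hconv : Convex ℝ S := by
    intro x hx y hy a b _ _ _
    have h := (Tendsto.const_mul a hx).add (Tendsto.const_mul b hy)
    simpa [S] using h
  have hclosed : IsClosed S := by
    refine isClosed_of_closure_subset fun x hx => ?_
    refine Metric.tendsto_nhds.2 fun ε hε => ?_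
    obtain ⟨y, hy, hxy⟩ := Metric.mem_closure_iff.1 hx (ε / 2) (half_pos hε)
    filter_upwards [Metric.tendsto_nhds.1 hy (ε / 2) (half_pos hε)] with R hR
    have h1 := abs_ballAverage_le R (x - y)
    rw [← dist_eq_norm, map_sub] at h1
    rw [Real.dist_eq, sub_zero] at hR ⊢
    have h2 := abs_sub_abs_le_abs_sub (ballAverage d R x) (ballAverage d R y)
    linarith
  by_contra hgS
  obtain ⟨Φ, s, hlt, hgt⟩ := geometric_hahn_banach_closed_point hconv hclosed (x := g) hgS
  exact absurd (le_of_tendsto' (hg Φ) fun k => (hlt (v k) (hv k)).le) (not_le.2 hgt)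

theorem continuous_ballAverage_translate {d : ℕ} (r : ℝ)
    (u : BoundedContinuousFunction (EuclideanSpace ℝ (Fin d)) ℝ) :
    Continuous fun x => ballAverage d r (translateBCF u x) := by
  have hfin : IsFiniteMeasure
      (volume.restrict (Metric.ball (0 : EuclideanSpace ℝ (Fin d)) r)) :=
    isFiniteMeasure_restrict.2 measure_ball_lt_top.ne
  have hcont : Continuous fun x =>
      ∫ y in Metric.ball (0 : EuclideanSpace ℝ (Fin d)) r, translateBCF u x y :=
    continuous_of_dominated (bound := fun _ => ‖u‖)
      (fun x => (translateBCF u x).continuous.aestronglyMeasurable)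
      (fun x => Eventually.of_forall fun y => u.norm_coe_le_norm (y + x))
      (integrable_const _)
      (Eventually.of_forall fun y => u.continuous.comp (continuous_const.add continuous_id))
  simp only [ballAverage_apply, setAverage_eq, smul_eq_mul]
  exact hcont.const_mul _

/-- The moving average `x ↦ ⨍ y in ball 0 r, u (x + y)`. -/
noncomputable def movingAverage {d : ℕ} (r : ℝ)
    (u : BoundedContinuousFunction (EuclideanSpace ℝ (Fin d)) ℝ) :
    BoundedContinuousFunction (EuclideanSpace ℝ (Fin d)) ℝ :=
  BoundedContinuousFunction.ofNormedAddCommGroup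
    (fun x => ballAverage d r (translateBCF u x))
    (continuous_ballAverage_translate r u)
    ‖u‖ fun _ => (abs_ballAverage_le r _).trans
      (BoundedContinuousFunction.norm_compContinuous_le u _)

theorem movingAverage_apply {d : ℕ} (r : ℝ)
    (u : BoundedContinuousFunction (EuclideanSpace ℝ (Fin d)) ℝ) (x : EuclideanSpace ℝ (Fin d)) :
    movingAverage r u x = ballAverage d r (translateBCF u x) := rfl

theorem ballAverage_movingAverage_comm {d : ℕ} (R r : ℝ)
    (u : BoundedContinuousFunction (EuclideanSpace ℝ (Fin d)) ℝ) :
    ballAverage d R (movingAverage r u) = ballAverage d r (movingAverage R u) := by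
  have hfin : ∀ s : ℝ, IsFiniteMeasure
      (volume.restrict (Metric.ball (0 : EuclideanSpace ℝ (Fin d)) s)) :=
    fun s => isFiniteMeasure_restrict.2 measure_ball_lt_top.ne
  have hR := hfin R
  have hr := hfin r
  simp only [ballAverage_apply, movingAverage_apply, setAverage_eq]
  rw [integral_smul, integral_smul, smul_comm, integral_integral_swap]
  · simp only [translateBCF, BoundedContinuousFunction.compContinuous_apply,
      ContinuousMap.coe_mk, add_comm]
  · let p : BoundedContinuousFunction
        (EuclideanSpace ℝ (Fin d) × EuclideanSpace ℝ (Fin d)) ℝ :=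
      u.compContinuous ⟨fun q => q.2 + q.1, continuous_snd.add continuous_fst⟩
    exact p.integrable _

theorem tendsto_ballAverage_movingAverage_sub {d : ℕ} {r : ℝ} (hr : 0 < r)
    (u : BoundedContinuousFunction (EuclideanSpace ℝ (Fin d)) ℝ) :
    Tendsto (fun R => ballAverage d R (movingAverage r u) - ballAverage d R u) atTop (𝓝 0) := by
  refine squeeze_zero_norm' ?_ (tendsto_translate_defect (d := d) (2 * ‖u‖) r)
  filter_upwards [eventually_gt_atTop r] with R hR
  rw [ballAverage_movingAverage_comm]
  have hball : volume.real (Metric.ball (0 : EuclideanSpace ℝ (Fin d)) r) ≠ 0 :=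
    (ENNReal.toReal_pos (Metric.measure_ball_pos volume _ hr).ne' measure_ball_lt_top.ne).ne'
  have hconst := ballAverage_const (d := d) hr (ballAverage d R u)
  rw [← hconst, ← map_sub, ballAverage_apply, setAverage_eq, norm_smul, norm_inv,
    Real.norm_of_nonneg measureReal_nonneg, inv_mul_le_iff₀ (by positivity), mul_comm]
  refine norm_setIntegral_le_of_norm_le_const measure_ball_lt_top fun l hl => ?_
  exact abs_ballAverage_translate_sub_le u hr.le hR (mem_ball_zero_iff.1 hl).le

/-- The limits of the centered moving averages of a weakly almost periodic function along any
sequence of points tend to zero. -/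
theorem IsWAP.tendsto_of_movingAverage {d : ℕ}
    {u : BoundedContinuousFunction (EuclideanSpace ℝ (Fin d)) ℝ} (hu : IsWAP u)
    (x : ℕ → EuclideanSpace ℝ (Fin d)) (a : ℕ → ℝ)
    (ha : ∀ n : ℕ, Tendsto (fun k => movingAverage (n + 1 : ℝ) u (x k) -
      ballAverage d (n + 1) u) atTop (𝓝 (a n))) :
    Tendsto a atTop (𝓝 0) := by
  obtain ⟨σ, g, hσ, hg⟩ := hu x
  have hzero := tendsto_ballAverage_zero_of_weak_limit
    (fun k => translateBCF u (x (σ k)) - u) (g - u)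
    (fun k => tendsto_ballAverage_translate_sub u _)
    (fun Φ => by simpa only [map_sub] using (hg Φ).sub_const (Φ u))
  have hval : ∀ n : ℕ, a n = ballAverage d (n + 1) (g - u) := fun n => by
    rw [map_sub]
    exact tendsto_nhds_unique ((ha n).comp hσ.tendsto_atTop)
      ((hg (ballAverage d (n + 1))).sub_const _)
  rw [funext hval]
  exact hzero.comp (tendsto_atTop_add_const_right _ _ tendsto_natCast_atTop_atTop)

/-- A weakly almost periodic function has a mean value along balls. -/
theorem IsWAP.exists_tendsto_ballAverage {d : ℕ}
    {u : BoundedContinuousFunction (EuclideanSpace ℝ (Fin d)) ℝ} (hu : IsWAP u) :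
    ∃ c, Tendsto (fun R => ballAverage d R u) atTop (𝓝 c) := by
  refine cauchy_map_iff_exists_tendsto.1 (Metric.cauchy_iff.2 ⟨inferInstance, fun ε hε => ?_⟩)
  obtain ⟨ι, t, w, z, hw, hsum, hle⟩ := exists_convex_combination_abs_le
    (fun (n : ℕ) x => movingAverage (n + 1 : ℝ) u x - ballAverage d (n + 1) u) (‖u‖ + ‖u‖)
    (fun n x => (abs_sub _ _).trans (add_le_add ((abs_ballAverage_le _ _).trans
      (BoundedContinuousFunction.norm_compContinuous_le u _)) (abs_ballAverage_le _ _)))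
    hu.tendsto_of_movingAverage (ε := ε / 4) (by positivity)
  let v : BoundedContinuousFunction (EuclideanSpace ℝ (Fin d)) ℝ :=
    ∑ i ∈ t, w i • (movingAverage (z i + 1 : ℝ) u -
      BoundedContinuousFunction.const _ (ballAverage d (z i + 1) u))
  have hv : ‖v‖ ≤ ε / 4 := by
    refine (BoundedContinuousFunction.norm_le (by positivity)).2 fun x => ?_
    simpa [v] using hle x
  let c := ∑ i ∈ t, w i * ballAverage d (z i + 1) u
  have hlim : Tendsto (fun R => ∑ i ∈ t, w i * (ballAverage d R (movingAverage (z i + 1 : ℝ) u) -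
      ballAverage d R u)) atTop (𝓝 0) := by
    have := tendsto_finsetSum t fun i _ =>
      (tendsto_ballAverage_movingAverage_sub (d := d) (r := z i + 1) (by positivity) u).const_mul
        (w i)
    simpa using this
  have hclose : ∀ᶠ R in atTop, dist (ballAverage d R u) c < ε / 2 := by
    filter_upwards [Metric.tendsto_nhds.1 hlim (ε / 4) (by positivity), eventually_gt_atTop 0]
      with R hR hR0
    have h1 := (abs_ballAverage_le R v).trans hv
    have h2 : ballAverage d R v = (∑ i ∈ t, w i * (ballAverage d R (movingAverage (z i + 1 : ℝ) u) -
        ballAverage d R u)) + (ballAverage d R u - c) := by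
      simp only [v, c, map_sum, map_smul, map_sub, ballAverage_const hR0, smul_eq_mul, mul_sub,
        Finset.sum_sub_distrib, ← Finset.sum_mul, hsum]
      ring
    rw [Real.dist_eq, sub_zero, abs_lt] at hR
    rw [h2, abs_le] at h1
    rw [Real.dist_eq, abs_lt]
    constructor <;> linarith [h1.1, h1.2, hR.1, hR.2]
  refine ⟨_, image_mem_map hclose, ?_⟩
  rintro _ ⟨R, hR, rfl⟩ _ ⟨R', hR', rfl⟩
  have hR₁ : dist (ballAverage d R u) c < ε / 2 := hR
  have hR₂ : dist (ballAverage d R' u) c < ε / 2 := hR'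
  linarith [dist_triangle_right (ballAverage d R u) (ballAverage d R' u) c]

/-- The reflected translate `y ↦ f (x - y)`. -/
noncomputable def reflectBCF {d : ℕ}
    (f : BoundedContinuousFunction (EuclideanSpace ℝ (Fin d)) ℝ) (x : EuclideanSpace ℝ (Fin d)) :
    BoundedContinuousFunction (EuclideanSpace ℝ (Fin d)) ℝ :=
  f.compContinuous ⟨fun y => x - y, continuous_const.sub continuous_id⟩

theorem norm_reflectBCF_sub_le {d : ℕ}
    (f g : BoundedContinuousFunction (EuclideanSpace ℝ (Fin d)) ℝ)
    (x : EuclideanSpace ℝ (Fin d)) : ‖reflectBCF f x - reflectBCF g x‖ ≤ ‖f - g‖ :=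
  BoundedContinuousFunction.norm_compContinuous_le (f - g) _

/-- The product of a reflected almost periodic function and a weakly almost periodic function is
weakly almost periodic. -/
theorem IsAP.isWAP_reflectBCF_mul {d : ℕ}
    {f φ : BoundedContinuousFunction (EuclideanSpace ℝ (Fin d)) ℝ}
    (hf : IsAP f) (hφ : IsWAP φ) (x : EuclideanSpace ℝ (Fin d)) :
    IsWAP (reflectBCF f x * φ) := by
  intro l
  obtain ⟨f', -, σ, hσ, hf'⟩ := hf.2.closure.isCompact_of_isClosed isClosed_closure
    |>.tendsto_subseq (x := fun k => translateBCF f (-l k)) fun k => subset_closure ⟨_, rfl⟩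
  obtain ⟨τ, φ', hτ, hφ'⟩ := hφ (l ∘ σ)
  refine ⟨σ ∘ τ, reflectBCF f' x * φ', hσ.comp hτ, fun Φ => ?_⟩
  have hprod : ∀ m, translateBCF (reflectBCF f x * φ) m =
      reflectBCF (translateBCF f (-m)) x * translateBCF φ m := fun m => by
    ext y
    simp only [translateBCF, reflectBCF, BoundedContinuousFunction.compContinuous_apply,
      BoundedContinuousFunction.mul_apply, ContinuousMap.coe_mk]
    rw [sub_add_eq_sub_sub, sub_eq_add_neg (x - y)]
  have hmain : Tendsto (fun j => Φ (reflectBCF f' x * translateBCF φ (l (σ (τ j))))) atTop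
      (𝓝 (Φ (reflectBCF f' x * φ'))) :=
    hφ' (Φ.comp (ContinuousLinearMap.mul ℝ _ (reflectBCF f' x)))
  have herr : Tendsto (fun j => (reflectBCF (translateBCF f (-l (σ (τ j)))) x - reflectBCF f' x) *
      translateBCF φ (l (σ (τ j)))) atTop (𝓝 0) := by
    have hsub := (tendsto_iff_norm_sub_tendsto_zero.1 (hf'.comp hτ.tendsto_atTop)).mul_const ‖φ‖
    rw [zero_mul] at hsub
    refine squeeze_zero_norm (fun j => (norm_mul_le _ _).trans ?_) hsub
    exact mul_le_mul (norm_reflectBCF_sub_le _ _ x)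
      (BoundedContinuousFunction.norm_compContinuous_le φ _) (norm_nonneg _) (norm_nonneg _)
  have hsum := (((Φ.continuous.tendsto 0).comp herr).add hmain)
  rw [map_zero, zero_add] at hsum
  refine hsum.congr fun j => ?_
  simp only [Function.comp_apply]
  rw [← map_add, sub_mul, sub_add_cancel, hprod]

/-- The mean-value convolution of an almost periodic function with a weakly almost periodic
function exists pointwise and is almost periodic. -/
theorem ap_meanConv_wap_isAP {d : ℕ}
    (f φ : BoundedContinuousFunction (EuclideanSpace ℝ (Fin d)) ℝ)
    (hf : IsAP f) (hφ : IsWAP φ) :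
    ∃ g : BoundedContinuousFunction (EuclideanSpace ℝ (Fin d)) ℝ,
      IsAP g ∧
      ∀ x : EuclideanSpace ℝ (Fin d),
        Tendsto (fun R : ℝ =>
            ⨍ y in Metric.ball (0 : EuclideanSpace ℝ (Fin d)) R, f (x - y) * φ y)
          atTop (𝓝 (g x)) := by
  choose g hg using fun x => (hf.isWAP_reflectBCF_mul hφ x).exists_tendsto_ballAverage
  have hdiff : ∀ x x' δ, 0 ≤ δ → (∀ y, |f (x - y) - f (x' - y)| ≤ δ) →
      |g x - g x'| ≤ δ * ‖φ‖ := by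
    intro x x' δ hδ h
    refine le_of_tendsto' ((hg x).sub (hg x')).abs fun R => ?_
    rw [← map_sub, ← sub_mul]
    refine (abs_ballAverage_le _ _).trans ((norm_mul_le _ _).trans ?_)
    gcongr
    exact (BoundedContinuousFunction.norm_le hδ).2 h
  have huc : UniformContinuous g := by
    refine Metric.uniformContinuous_iff.2 fun ε hε => ?_
    have hφ1 : 0 < ‖φ‖ + 1 := by positivity
    obtain ⟨δ, hδ, h⟩ := Metric.uniformContinuous_iff.1 hf.1 (ε / (‖φ‖ + 1)) (by positivity)
    refine ⟨δ, hδ, fun x x' hxx' => ?_⟩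
    have hle := hdiff x x' (ε / (‖φ‖ + 1)) (by positivity) fun y =>
      (h (by rwa [dist_sub_right])).le
    refine lt_of_le_of_lt hle ?_
    rw [div_mul_eq_mul_div, div_lt_iff₀ hφ1]
    nlinarith
  let G : BoundedContinuousFunction (EuclideanSpace ℝ (Fin d)) ℝ :=
    BoundedContinuousFunction.ofNormedAddCommGroup g huc.continuous (‖f‖ * ‖φ‖) fun x =>
      le_of_tendsto' (hg x).norm fun R => (abs_ballAverage_le _ _).trans
        ((norm_mul_le _ _).trans (mul_le_mul_of_nonneg_right
          (BoundedContinuousFunction.norm_compContinuous_le f _) (norm_nonneg _)))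
  have hlip : ∀ l l', dist (translateBCF G l) (translateBCF G l') ≤
      dist (translateBCF f l) (translateBCF f l') * ‖φ‖ := by
    intro l l'
    refine (BoundedContinuousFunction.dist_le (by positivity)).2 fun x => ?_
    refine hdiff (x + l) (x + l') _ dist_nonneg fun y => ?_
    have h := BoundedContinuousFunction.dist_coe_le_dist
      (f := translateBCF f l) (g := translateBCF f l') (x - y)
    simpa [translateBCF, Real.dist_eq, sub_add_eq_add_sub] using h
  refine ⟨G, ⟨huc, Metric.totallyBounded_iff.2 fun ε hε => ?_⟩, hg⟩
  have hφ1 : 0 < ‖φ‖ + 1 := by positivity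
  obtain ⟨t, hts, htf, hcov⟩ :=
    Metric.finite_approx_of_totallyBounded hf.2 (ε / (‖φ‖ + 1)) (by positivity)
  have hpoint : ∀ u ∈ t, ∃ l, u = translateBCF f l := fun u hu => hts hu
  choose! m hm using hpoint
  refine ⟨(fun u => translateBCF G (m u)) '' t, htf.image _, ?_⟩
  rintro _ ⟨l, rfl⟩
  obtain ⟨u, hut, hu⟩ := Set.mem_iUnion₂.1 (hcov ⟨l, rfl⟩)
  refine Set.mem_iUnion₂.2 ⟨_, ⟨u, hut, rfl⟩, lt_of_le_of_lt (hlip l (m u)) ?_⟩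
  rw [← hm u hut]
  have hu' : dist (translateBCF f l) u < ε / (‖φ‖ + 1) := hu
  rw [lt_div_iff₀ hφ1] at hu'
  have : 0 ≤ dist (translateBCF f l) u := dist_nonneg
  linarith
end

section
/- Compactification theorem for algebras with mean value: let 𝒜 be a subset of BUC(ℝ^d) that is a linear subspace and subalgebra (closed under pointwise products), closed in the sup norm, containing the constant function 1, invariant under all translations f ↦ f(·+y) (y ∈ ℝ^d), such that every f ∈ 𝒜 possesses a mean value M(f). Then there exist a compact Hausdorff topological space K, an isometric unital algebra isomorphism ι : 𝒜 → C(K; ℝ) onto the algebra of continuous real functions on K, a jointly continuous map T : ℝ^d × K → K with T(0,·) = id and T(y+z, ·) = T(y, T(z, ·)) for all y, z ∈ ℝ^d (so each T(y,·) is a homeomorphism of K), satisfying ι(f(·+y)) = ι(f) ∘ T(y,·) for all f ∈ 𝒜 and y ∈ ℝ^d, and a regular Borel probability measure 𝔪 on K invariant under every T(y,·) such that M(f) = ∫_K ι(f) d𝔪 for all f ∈ 𝒜. -/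
open MeasureTheory Filter Topology

open scoped BoundedContinuousFunction CompactlySupported

namespace BoundedContinuousFunction

variable {X : Type*} [TopologicalSpace X]

/-- The compactification of `X` attached to an algebra `A` of bounded continuous functions: the
closure in `ℝ^A` of the image of `X` under the evaluation map. -/
def Compactification (A : Subalgebra ℝ (X →ᵇ ℝ)) : Type _ :=
  closure (Set.range fun (x : X) (f : A) => (f : X →ᵇ ℝ) x)

variable (A : Subalgebra ℝ (X →ᵇ ℝ))

instance : TopologicalSpace (Compactification A) :=
  inferInstanceAs (TopologicalSpace (closure _))

instance : T2Space (Compactification A) :=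
  inferInstanceAs (T2Space (closure _))

instance : CompactSpace (Compactification A) := by
  refine isCompact_iff_compactSpace.mp (IsCompact.of_isClosed_subset
    (isCompact_univ_pi fun f : A => isCompact_closedBall (0 : ℝ) ‖(f : X →ᵇ ℝ)‖)
    isClosed_closure (closure_minimal ?_ ?_))
  · rintro _ ⟨x, rfl⟩ f -
    simpa using (f : X →ᵇ ℝ).norm_coe_le_norm x
  · exact isClosed_set_pi fun f _ => Metric.isClosed_closedBall

instance : MeasurableSpace (Compactification A) :=
  borel _

instance : BorelSpace (Compactification A) :=
  ⟨rfl⟩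

variable {A}

/-- The canonical map of `X` into its compactification. -/
def toCompactification (x : X) : Compactification A :=
  ⟨fun f => (f : X →ᵇ ℝ) x, subset_closure ⟨x, rfl⟩⟩

theorem denseRange_toCompactification :
    DenseRange (toCompactification : X → Compactification A) := by
  refine Subtype.dense_iff.mpr fun k hk => closure_mono ?_ hk
  rintro _ ⟨x, rfl⟩
  exact ⟨toCompactification x, ⟨x, rfl⟩, rfl⟩

/-- The continuous extension of the members of `A` to the compactification. -/
def extendAlgHom (A : Subalgebra ℝ (X →ᵇ ℝ)) : A →ₐ[ℝ] C(Compactification A, ℝ) where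
  toFun f := ⟨fun k => k.1 f, (continuous_apply f).comp continuous_subtype_val⟩
  map_one' := DFunLike.coe_injective <| denseRange_toCompactification.equalizer
    (ContinuousMap.continuous _) (ContinuousMap.continuous _) rfl
  map_mul' _ _ := DFunLike.coe_injective <| denseRange_toCompactification.equalizer
    (ContinuousMap.continuous _) (ContinuousMap.continuous _) rfl
  map_zero' := DFunLike.coe_injective <| denseRange_toCompactification.equalizer
    (ContinuousMap.continuous _) (ContinuousMap.continuous _) rfl
  map_add' _ _ := DFunLike.coe_injective <| denseRange_toCompactification.equalizer
    (ContinuousMap.continuous _) (ContinuousMap.continuous _) rfl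
  commutes' _ := DFunLike.coe_injective <| denseRange_toCompactification.equalizer
    (ContinuousMap.continuous _) (ContinuousMap.continuous _) rfl

theorem norm_extendAlgHom (f : A) : ‖extendAlgHom A f‖ = ‖f‖ := by
  apply le_antisymm
  · refine (ContinuousMap.norm_le _ (norm_nonneg f)).mpr fun k => ?_
    refine denseRange_toCompactification.induction_on
      (p := fun k => ‖extendAlgHom A f k‖ ≤ ‖f‖) k ?_ fun x => ?_
    · exact isClosed_le (extendAlgHom A f).continuous.norm continuous_const
    · exact (f : X →ᵇ ℝ).norm_coe_le_norm x
  · exact (norm_le (norm_nonneg _)).mpr fun x =>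
      (extendAlgHom A f).norm_coe_le_norm (toCompactification x)

theorem isometry_extendAlgHom : Isometry (extendAlgHom A) :=
  Isometry.of_dist_eq fun f g => by
    rw [dist_eq_norm, ← map_sub, norm_extendAlgHom]
    exact (dist_eq_norm (f : X →ᵇ ℝ) g).symm

theorem surjective_extendAlgHom (hA : IsClosed (A : Set (X →ᵇ ℝ))) :
    Function.Surjective (extendAlgHom A) := by
  have : CompleteSpace A := hA.completeSpace_coe
  have hclosed : IsClosed ((extendAlgHom A).range : Set C(Compactification A, ℝ)) := by
    rw [AlgHom.coe_range]
    exact isometry_extendAlgHom.isClosedEmbedding.isClosed_range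
  have hsep : (extendAlgHom A).range.SeparatesPoints := by
    intro k l hkl
    obtain ⟨f, hf⟩ := Function.ne_iff.mp (fun h => hkl (Subtype.ext h))
    exact ⟨_, ⟨_, ⟨f, rfl⟩, rfl⟩, hf⟩
  have htop := ContinuousMap.subalgebra_topologicalClosure_eq_top_of_separatesPoints _ hsep
  refine (AlgHom.range_eq_top _).mp (top_le_iff.mp ?_)
  rw [← htop]
  exact Subalgebra.topologicalClosure_minimal le_rfl hclosed

theorem nonneg_of_extendAlgHom_nonneg {f : A} (hf : 0 ≤ extendAlgHom A f) :
    0 ≤ (f : X →ᵇ ℝ) :=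
  fun x => hf (toCompactification x)

end BoundedContinuousFunction

section Mean

theorem tendsto_average_ball_smul {E : Type*} [NormedAddCommGroup E] [MeasurableSpace E]
    {μ : Measure E} {f : E →ᵇ ℝ} {a : ℝ} (c : ℝ)
    (ha : Tendsto (fun R : ℝ => ⨍ x in Metric.ball (0 : E) R, f x ∂μ) atTop (𝓝 a)) :
    Tendsto (fun R : ℝ => ⨍ x in Metric.ball (0 : E) R, (c • f) x ∂μ) atTop (𝓝 (c * a)) := by
  refine (ha.const_mul c).congr fun R => ?_
  simp only [setAverage_eq, BoundedContinuousFunction.coe_smul, smul_eq_mul]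
  rw [integral_const_mul]
  ring

theorem tendsto_average_ball_const {E : Type*} [NormedAddCommGroup E] [NormedSpace ℝ E]
    [FiniteDimensional ℝ E] [MeasurableSpace E] {μ : Measure E} [μ.IsAddHaarMeasure] (c : ℝ) :
    Tendsto (fun R : ℝ => ⨍ _ in Metric.ball (0 : E) R, c ∂μ) atTop (𝓝 c) := by
  refine tendsto_const_nhds.congr' ?_
  filter_upwards [eventually_gt_atTop 0] with R hR
  exact (setAverage_const (Metric.measure_ball_pos μ 0 hR).ne' measure_ball_lt_top.ne c).symm

variable {E : Type*} [NormedAddCommGroup E] [NormedSpace ℝ E] [FiniteDimensional ℝ E]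
  [MeasurableSpace E] [BorelSpace E] {μ : Measure E} [μ.IsAddHaarMeasure]

theorem BoundedContinuousFunction.integrableOn_ball (f : E →ᵇ ℝ) (x : E) (R : ℝ) :
    IntegrableOn f (Metric.ball x R) μ :=
  (f.continuous.locallyIntegrable.integrableOn_isCompact
    (isCompact_closedBall x R)).mono_set Metric.ball_subset_closedBall

theorem tendsto_measureReal_ball_add_div (r : ℝ) :
    Tendsto (fun R : ℝ => μ.real (Metric.ball (0 : E) (R + r)) / μ.real (Metric.ball (0 : E) R))
      atTop (𝓝 1) := by
  have hlim : Tendsto (fun R : ℝ => (1 + r / R) ^ Module.finrank ℝ E) atTop (𝓝 1) := by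
    simpa using ((tendsto_const_nhds (x := (1 : ℝ))).add
      (tendsto_const_nhds.div_atTop tendsto_id)).pow (Module.finrank ℝ E)
  refine hlim.congr' ?_
  filter_upwards [eventually_gt_atTop 0, eventually_gt_atTop (-r)] with R hR hRr
  have hball : ∀ s : ℝ, 0 < s → μ.real (Metric.ball (0 : E) s)
      = s ^ Module.finrank ℝ E * μ.real (Metric.ball (0 : E) 1) := by
    intro s hs
    rw [measureReal_def, Measure.addHaar_ball_of_pos μ 0 hs, ENNReal.toReal_mul,
      ENNReal.toReal_ofReal (by positivity), measureReal_def]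
  have hone : 0 < μ.real (Metric.ball (0 : E) 1) :=
    ENNReal.toReal_pos (Metric.measure_ball_pos μ 0 one_pos).ne' measure_ball_lt_top.ne
  rw [hball R hR, hball (R + r) (by linarith), mul_div_mul_right _ _ hone.ne', ← div_pow]
  congr 1
  field_simp

/-- A mean value of a nonnegative function dominates the mean values of its translates. -/
theorem mean_translate_le_of_nonneg {f g : E →ᵇ ℝ} {y : E} (hf : 0 ≤ f)
    (hg : ∀ x, g x = f (x + y)) {a b : ℝ}
    (ha : Tendsto (fun R : ℝ => ⨍ x in Metric.ball (0 : E) R, f x ∂μ) atTop (𝓝 a))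
    (hb : Tendsto (fun R : ℝ => ⨍ x in Metric.ball (0 : E) R, g x ∂μ) atTop (𝓝 b)) :
    b ≤ a := by
  have hlim := (tendsto_measureReal_ball_add_div (μ := μ) ‖y‖).mul
    (ha.comp (tendsto_atTop_add_const_right atTop ‖y‖ tendsto_id))
  rw [one_mul] at hlim
  refine le_of_tendsto_of_tendsto hb hlim ?_
  filter_upwards [eventually_gt_atTop 0] with R hR
  have hpos : ∀ s : ℝ, 0 < s → 0 < μ.real (Metric.ball (0 : E) s) := fun s hs =>
    ENNReal.toReal_pos (Metric.measure_ball_pos μ 0 hs).ne' measure_ball_lt_top.ne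
  have hint : ∫ x in Metric.ball (0 : E) R, g x ∂μ
      ≤ ∫ x in Metric.ball (0 : E) (R + ‖y‖), f x ∂μ := by
    have hshift : ∫ x in Metric.ball (0 : E) R, g x ∂μ = ∫ x in Metric.ball y R, f x ∂μ := by
      have hpre : (fun x => x + y) ⁻¹' Metric.ball y R = Metric.ball (0 : E) R := by
        ext x
        simp
      have := (measurePreserving_add_right μ y).setIntegral_preimage_emb
        (measurableEmbedding_addRight y) f (Metric.ball y R)
      simpa only [hpre, hg] using this
    rw [hshift]
    refine setIntegral_mono_set (f.integrableOn_ball _ _) (ae_of_all _ hf)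
      (Metric.ball_subset_ball' ?_).eventuallyLE
    simp
  simp only [Function.comp_apply, id, setAverage_eq, smul_eq_mul]
  have h₁ := hpos R hR
  have h₂ := hpos (R + ‖y‖) (by positivity)
  calc _ ≤ (μ.real (Metric.ball (0 : E) R))⁻¹
        * ∫ x in Metric.ball (0 : E) (R + ‖y‖), f x ∂μ := by gcongr
    _ = _ := by field_simp

theorem tendsto_average_ball_add {f g : E →ᵇ ℝ} {a b : ℝ}
    (ha : Tendsto (fun R : ℝ => ⨍ x in Metric.ball (0 : E) R, f x ∂μ) atTop (𝓝 a))
    (hb : Tendsto (fun R : ℝ => ⨍ x in Metric.ball (0 : E) R, g x ∂μ) atTop (𝓝 b)) :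
    Tendsto (fun R : ℝ => ⨍ x in Metric.ball (0 : E) R, (f + g) x ∂μ) atTop (𝓝 (a + b)) := by
  refine (ha.add hb).congr fun R => ?_
  simp only [setAverage_eq, BoundedContinuousFunction.coe_add, Pi.add_apply]
  rw [integral_add (f.integrableOn_ball _ _) (g.integrableOn_ball _ _), smul_add]

theorem mean_translate_le {f g : E →ᵇ ℝ} {y : E} (hg : ∀ x, g x = f (x + y)) {a b : ℝ}
    (ha : Tendsto (fun R : ℝ => ⨍ x in Metric.ball (0 : E) R, f x ∂μ) atTop (𝓝 a))
    (hb : Tendsto (fun R : ℝ => ⨍ x in Metric.ball (0 : E) R, g x ∂μ) atTop (𝓝 b)) :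
    b ≤ a := by
  have hconst : Tendsto (fun R : ℝ => ⨍ x in Metric.ball (0 : E) R,
      BoundedContinuousFunction.const E ‖f‖ x ∂μ) atTop (𝓝 ‖f‖) := tendsto_average_ball_const ‖f‖
  have hle := mean_translate_le_of_nonneg (f := f + .const E ‖f‖) (g := g + .const E ‖f‖) (y := y)
    (fun x => by
      have := (abs_le.mp (f.norm_coe_le_norm x)).1
      change 0 ≤ f x + ‖f‖
      linarith)
    (fun x => by simp [hg]) (tendsto_average_ball_add ha hconst)
    (tendsto_average_ball_add hb hconst)
  linarith

/-- Mean values are invariant under translations. -/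
theorem mean_translate_eq {f g : E →ᵇ ℝ} {y : E} (hg : ∀ x, g x = f (x + y)) {a b : ℝ}
    (ha : Tendsto (fun R : ℝ => ⨍ x in Metric.ball (0 : E) R, f x ∂μ) atTop (𝓝 a))
    (hb : Tendsto (fun R : ℝ => ⨍ x in Metric.ball (0 : E) R, g x ∂μ) atTop (𝓝 b)) :
    b = a :=
  le_antisymm (mean_translate_le hg ha hb)
    (mean_translate_le (y := -y) (fun x => by simp [hg]) hb ha)

end Mean

/-- A positive unital functional on `C(K, ℝ)`, for `K` compact Hausdorff, is represented by a
regular Borel probability measure. -/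
theorem exists_regular_isProbabilityMeasure_integral_eq {K : Type*} [TopologicalSpace K]
    [CompactSpace K] [T2Space K] [MeasurableSpace K] [BorelSpace K] (Λ : C(K, ℝ) →ₗ[ℝ] ℝ)
    (hpos : ∀ φ, 0 ≤ φ → 0 ≤ Λ φ) (hone : Λ 1 = 1) :
    ∃ 𝔪 : Measure K, IsProbabilityMeasure 𝔪 ∧ 𝔪.Regular ∧ ∀ φ : C(K, ℝ), ∫ k, φ k ∂𝔪 = Λ φ := by
  let Λc : C_c(K, ℝ) →ₗ[ℝ] ℝ :=
    { toFun := fun φ => Λ φ.toContinuousMap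
      map_add' := fun φ ψ => Λ.map_add φ.toContinuousMap ψ.toContinuousMap
      map_smul' := fun c φ => Λ.map_smul c φ.toContinuousMap }
  let 𝔪 := RealRMK.rieszMeasure (PositiveLinearMap.mk₀ Λc fun φ hφ => hpos _ hφ)
  have hint : ∀ φ : C(K, ℝ), ∫ k, φ k ∂𝔪 = Λ φ := fun φ =>
    RealRMK.integral_rieszMeasure _ (CompactlySupportedContinuousMap.continuousMapEquiv φ)
  refine ⟨𝔪, ⟨?_⟩, inferInstance, hint⟩
  have huniv : 𝔪.real Set.univ = 1 := by
    simpa [hone] using hint 1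
  rw [measureReal_def] at huniv
  exact (ENNReal.toReal_eq_one_iff _).mp huniv

/-- Translates of a bounded uniformly continuous function depend continuously on the shift. -/
theorem continuous_translateBCF {d : ℕ} {f : EuclideanSpace ℝ (Fin d) →ᵇ ℝ}
    (hf : UniformContinuous f) : Continuous (translateBCF f) := by
  refine Metric.continuous_iff.mpr fun y ε hε => ?_
  obtain ⟨δ, hδ, hfδ⟩ := Metric.uniformContinuous_iff.mp hf (ε / 2) (half_pos hε)
  refine ⟨δ, hδ, fun z hz => lt_of_le_of_lt ?_ (half_lt_self hε)⟩
  refine (BoundedContinuousFunction.dist_le (half_pos hε).le).mpr fun x => (hfδ ?_).le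
  simpa using hz

namespace BoundedContinuousFunction

section Action

variable {d : ℕ} {A : Subalgebra ℝ (EuclideanSpace ℝ (Fin d) →ᵇ ℝ)}
  (hA : ∀ f ∈ A, ∀ y : EuclideanSpace ℝ (Fin d), translateBCF f y ∈ A)

/-- The extension of the translations to the compactification attached to a translation-invariant
algebra. -/
noncomputable def Compactification.translate (y : EuclideanSpace ℝ (Fin d)) (k : Compactification A) :
    Compactification A :=
  ⟨fun f => k.1 ⟨translateBCF f y, hA f f.2 y⟩, by
    refine map_mem_closure (f := fun (k : A → ℝ) (f : A) => k ⟨translateBCF f y, hA f f.2 y⟩)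
      (continuous_pi fun f => continuous_apply _) k.2 ?_
    rintro _ ⟨x, rfl⟩
    exact ⟨x + y, rfl⟩⟩

theorem extendAlgHom_translate (f : A) (y : EuclideanSpace ℝ (Fin d)) (k : Compactification A) :
    extendAlgHom A f (Compactification.translate hA y k)
      = extendAlgHom A ⟨translateBCF f y, hA f f.2 y⟩ k :=
  rfl

theorem Compactification.translate_zero (k : Compactification A) :
    Compactification.translate hA 0 k = k := by
  refine Subtype.ext (funext fun f => congrArg k.1 (Subtype.ext ?_))
  ext x
  exact congrArg (f : EuclideanSpace ℝ (Fin d) →ᵇ ℝ) (add_zero x)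

theorem Compactification.translate_add (y z : EuclideanSpace ℝ (Fin d)) (k : Compactification A) :
    Compactification.translate hA (y + z) k
      = Compactification.translate hA y (Compactification.translate hA z k) := by
  refine Subtype.ext (funext fun f => congrArg k.1 (Subtype.ext ?_))
  ext x
  refine congrArg (f : EuclideanSpace ℝ (Fin d) →ᵇ ℝ) ?_
  change x + (y + z) = x + z + y
  abel

theorem Compactification.continuous_translate (hBUC : ∀ f ∈ A, UniformContinuous f) :
    Continuous fun p : EuclideanSpace ℝ (Fin d) × Compactification A =>
      Compactification.translate hA p.1 p.2 := by
  refine Continuous.subtype_mk (continuous_pi fun f => ?_) _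
  have hext : Continuous fun y : EuclideanSpace ℝ (Fin d) =>
      extendAlgHom A ⟨translateBCF f y, hA f f.2 y⟩ :=
    isometry_extendAlgHom.continuous.comp
      ((continuous_translateBCF (hBUC f f.2)).subtype_mk fun y => hA f f.2 y)
  exact (hext.comp continuous_fst).eval continuous_snd

/-- The translation by `y`, as a homeomorphism of the compactification. -/
noncomputable def Compactification.translateHomeomorph (hBUC : ∀ f ∈ A, UniformContinuous f)
    (y : EuclideanSpace ℝ (Fin d)) : Compactification A ≃ₜ Compactification A where
  toFun := Compactification.translate hA y
  invFun := Compactification.translate hA (-y)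
  left_inv k := by rw [← translate_add, neg_add_cancel, translate_zero]
  right_inv k := by rw [← translate_add, add_neg_cancel, translate_zero]
  continuous_toFun := (continuous_translate hA hBUC).comp (Continuous.prodMk_right y)
  continuous_invFun := (continuous_translate hA hBUC).comp (Continuous.prodMk_right (-y))

end Action

end BoundedContinuousFunction

/-- Compactification theorem for algebras with mean value: an algebra with mean value `𝒜`
(a translation-invariant, sup-norm-closed unital subalgebra of `BUC(ℝ^d)` all of whose members
possess a mean value `M`) is isometrically isomorphic to `C(K)` for a compact Hausdorff space
`K` carrying a continuous `ℝ^d`-dynamical system `T` extending the translations and an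
invariant regular Borel probability measure `𝔪` representing the mean value. -/
theorem algebra_with_mean_value_compactification {d : ℕ}
    (𝒜 : Set (BoundedContinuousFunction (EuclideanSpace ℝ (Fin d)) ℝ))
    (hBUC : ∀ f ∈ 𝒜, UniformContinuous ⇑f)
    (hadd : ∀ f ∈ 𝒜, ∀ g ∈ 𝒜, f + g ∈ 𝒜)
    (hsmul : ∀ (c : ℝ), ∀ f ∈ 𝒜, c • f ∈ 𝒜)
    (hmul : ∀ f ∈ 𝒜, ∀ g ∈ 𝒜, f * g ∈ 𝒜)
    (hclosed : IsClosed 𝒜)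
    (hone : (1 : BoundedContinuousFunction (EuclideanSpace ℝ (Fin d)) ℝ) ∈ 𝒜)
    (htrans : ∀ f ∈ 𝒜, ∀ y : EuclideanSpace ℝ (Fin d), translateBCF f y ∈ 𝒜)
    (M : BoundedContinuousFunction (EuclideanSpace ℝ (Fin d)) ℝ → ℝ)
    (hM : ∀ f ∈ 𝒜, Tendsto (fun R : ℝ =>
        ⨍ y in Metric.ball (0 : EuclideanSpace ℝ (Fin d)) R, f y) atTop (𝓝 (M f))) :
    ∃ (K : Type) (tK : TopologicalSpace K) (mK : MeasurableSpace K)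
      (_ : BorelSpace K) (_ : CompactSpace K) (_ : T2Space K)
      (ι : BoundedContinuousFunction (EuclideanSpace ℝ (Fin d)) ℝ → C(K, ℝ))
        (T : EuclideanSpace ℝ (Fin d) → K → K) (𝔪 : Measure K),
        -- `ι` is a norm-preserving unital algebra morphism of `𝒜` onto `C(K, ℝ)`
        (∀ f ∈ 𝒜, ‖ι f‖ = ‖f‖) ∧
        (∀ f ∈ 𝒜, ∀ g ∈ 𝒜, ι (f + g) = ι f + ι g) ∧
        (∀ (c : ℝ), ∀ f ∈ 𝒜, ι (c • f) = c • ι f) ∧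
        (∀ f ∈ 𝒜, ∀ g ∈ 𝒜, ι (f * g) = ι f * ι g) ∧
        ι 1 = 1 ∧
        (∀ φ : C(K, ℝ), ∃ f ∈ 𝒜, ι f = φ) ∧
        (∀ f ∈ 𝒜, ∀ g ∈ 𝒜, ι f = ι g → f = g) ∧
        -- `T` is a jointly continuous group action of `ℝ^d` extending the translations
        Continuous (fun p : EuclideanSpace ℝ (Fin d) × K => T p.1 p.2) ∧
        (∀ k : K, T 0 k = k) ∧
        (∀ (y z : EuclideanSpace ℝ (Fin d)) (k : K), T (y + z) k = T y (T z k)) ∧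
        (∀ f ∈ 𝒜, ∀ (y : EuclideanSpace ℝ (Fin d)) (k : K),
          ι (translateBCF f y) k = ι f (T y k)) ∧
        -- `𝔪` is an invariant regular Borel probability measure representing the mean value
        IsProbabilityMeasure 𝔪 ∧ 𝔪.Regular ∧
        (∀ y : EuclideanSpace ℝ (Fin d), Measure.map (T y) 𝔪 = 𝔪) ∧
        (∀ f ∈ 𝒜, M f = ∫ k, ι f k ∂𝔪) := by
  classical
  let A : Subalgebra ℝ (EuclideanSpace ℝ (Fin d) →ᵇ ℝ) :=
    { carrier := 𝒜
      mul_mem' := fun {f g} hf hg => hmul f hf g hg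
      add_mem' := fun {f g} hf hg => hadd f hf g hg
      algebraMap_mem' := fun c => by
        rw [Algebra.algebraMap_eq_smul_one]
        exact hsmul c 1 hone }
  have hMadd : ∀ f g : A, M (f + g : A) = M f + M g := fun f g =>
    tendsto_nhds_unique (hM _ (f + g).2) (tendsto_average_ball_add (hM f f.2) (hM g g.2))
  have hMsmul : ∀ (c : ℝ) (f : A), M (c • f : A) = c * M f := fun c f =>
    tendsto_nhds_unique (hM _ (c • f).2) (tendsto_average_ball_smul c (hM f f.2))
  let mean : A →ₗ[ℝ] ℝ := { toFun := fun f => M f, map_add' := hMadd, map_smul' := hMsmul }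
  let e : A ≃ₐ[ℝ] C(BoundedContinuousFunction.Compactification A, ℝ) :=
    AlgEquiv.ofBijective (BoundedContinuousFunction.extendAlgHom A)
      ⟨BoundedContinuousFunction.isometry_extendAlgHom.injective,
        BoundedContinuousFunction.surjective_extendAlgHom hclosed⟩
  obtain ⟨𝔪, hprob, hreg, hint⟩ := exists_regular_isProbabilityMeasure_integral_eq
    (mean ∘ₗ e.symm.toLinearMap)
    (fun φ hφ => by
      have hnonneg : 0 ≤ (e.symm φ : EuclideanSpace ℝ (Fin d) →ᵇ ℝ) :=
        BoundedContinuousFunction.nonneg_of_extendAlgHom_nonneg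
          (hφ.trans_eq (e.apply_symm_apply φ).symm)
      refine ge_of_tendsto' (hM _ (e.symm φ).2) fun R => ?_
      rw [setAverage_eq]
      exact smul_nonneg (by positivity) (integral_nonneg hnonneg))
    (by
      change M (e.symm 1 : A) = 1
      rw [map_one]
      exact tendsto_nhds_unique (hM 1 hone) (tendsto_average_ball_const 1))
  have hmean : ∀ f : A, M f = ∫ k, BoundedContinuousFunction.extendAlgHom A f k ∂𝔪 := fun f => by
    rw [hint]
    exact congrArg mean (e.symm_apply_apply f).symm
  let ι : (EuclideanSpace ℝ (Fin d) →ᵇ ℝ) → C(BoundedContinuousFunction.Compactification A, ℝ) :=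
    fun f => if hf : f ∈ A then BoundedContinuousFunction.extendAlgHom A ⟨f, hf⟩ else 0
  have hι : ∀ (f) (hf : f ∈ 𝒜), ι f = BoundedContinuousFunction.extendAlgHom A ⟨f, hf⟩ :=
    fun f hf => dif_pos hf
  refine ⟨BoundedContinuousFunction.Compactification A, inferInstance, inferInstance,
    inferInstance, inferInstance, inferInstance, ι,
    BoundedContinuousFunction.Compactification.translate htrans, 𝔪, ?_, ?_, ?_, ?_, ?_, ?_, ?_,
    BoundedContinuousFunction.Compactification.continuous_translate htrans hBUC,
    BoundedContinuousFunction.Compactification.translate_zero htrans,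
    BoundedContinuousFunction.Compactification.translate_add htrans, ?_, hprob, hreg, ?_, ?_⟩
  · intro f hf
    rw [hι f hf]
    exact BoundedContinuousFunction.norm_extendAlgHom _
  · intro f hf g hg
    rw [hι f hf, hι g hg, hι _ (hadd f hf g hg), ← map_add]
    rfl
  · intro c f hf
    rw [hι f hf, hι _ (hsmul c f hf), ← map_smul]
    rfl
  · intro f hf g hg
    rw [hι f hf, hι g hg, hι _ (hmul f hf g hg), ← map_mul]
    rfl
  · rw [hι 1 hone]
    exact map_one _
  · intro φ
    refine ⟨e.symm φ, (e.symm φ).2, ?_⟩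
    rw [hι _ (e.symm φ).2]
    exact e.apply_symm_apply φ
  · intro f hf g hg hfg
    rw [hι f hf, hι g hg] at hfg
    exact congrArg Subtype.val (BoundedContinuousFunction.isometry_extendAlgHom.injective hfg)
  · intro f hf y k
    rw [hι f hf, hι _ (htrans f hf y)]
    rfl
  · intro y
    have hmap : (Measure.map (BoundedContinuousFunction.Compactification.translate htrans y)
        𝔪).Regular :=
      Measure.Regular.map (μ := 𝔪)
        (BoundedContinuousFunction.Compactification.translateHomeomorph (A := A) htrans hBUC y)
    refine Measure.ext_of_integral_eq_on_compactlySupported fun φ => ?_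
    obtain ⟨f, hf⟩ := e.surjective φ.toContinuousMap
    have hφ : ∀ k, φ k = BoundedContinuousFunction.extendAlgHom A f k :=
      fun k => (DFunLike.congr_fun hf k).symm
    have hmeas :
        Measurable (BoundedContinuousFunction.Compactification.translate (A := A) htrans y) :=
      (BoundedContinuousFunction.Compactification.translateHomeomorph htrans hBUC y).measurable
    simp only [hφ]
    rw [integral_map hmeas.aemeasurable (ContinuousMap.continuous _).aestronglyMeasurable]
    simp only [BoundedContinuousFunction.extendAlgHom_translate]
    rw [← hmean, ← hmean]
    exact mean_translate_eq (fun x => rfl) (hM f f.2) (hM _ (htrans f f.2 y))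
  · intro f hf
    rw [hι f hf]
    exact hmean ⟨f, hf⟩
end
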